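/- arXiv:1810.09117 — 2 statements merged into one kernel-verified Lean document; each statement's English description precedes it below -/
import Mathlib

section
/- Let P ⊆ ℂ be nonempty, compact and contractible with empty interior in ℂ, and let A : P → ℂ^{n×n} and b : P → ℂ^n be continuous such that for every θ ∈ P the Kalman matrix (b(θ), A(θ)b(θ), …, A(θ)^{n−1}b(θ)) has rank n and such that σ(A(θ)) ∩ σ(A(θ′)) = ∅ for all θ ≠ θ′ in P. If there exist constants c_1, …, c_{n−1} ∈ ℂ and a continuous function a_0 : P → ℂ such that the characteristic polynomial of A(θ) equals z^n + c_{n−1} z^{n−1} + ⋯ + c_1 z + a_0(θ) for all θ ∈ P, then (A, b) is uniformly ensemble reachable on C(P, ℂ^n). -/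
open Polynomial Matrix

/-- Uniform ensemble reachability of a single-input pair `(A, b)` on `C(P, ℂ^n)`. -/
def UniformEnsembleReachable1 {n : ℕ} (P : Set ℂ)
    (A : P → Matrix (Fin n) (Fin n) ℂ) (b : P → Fin n → ℂ) : Prop :=
  ∀ f : P → Fin n → ℂ, Continuous f → ∀ ε : ℝ, 0 < ε →
    ∃ p : Polynomial ℂ, ∀ θ : P, ‖(Polynomial.aeval (A θ) p).mulVec (b θ) - f θ‖ < ε

open Polynomial Matrix

namespace EnsReach

open Topology

/-- Continuous logarithms on contractible spaces. -/
lemma exists_log {X : Type*} [TopologicalSpace X] [ContractibleSpace X] (f : C(X, ℂ))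
    (hf : ∀ x, f x ≠ 0) : ∃ g : C(X, ℂ), ∀ x, Complex.exp (g x) = f x := by
  obtain ⟨y, ⟨H⟩⟩ := id_nullhomotopic X
  have H' := H.symm
  let F : C(X, {z : ℂ // z ≠ 0}) := ⟨fun x => ⟨f x, hf x⟩, by fun_prop⟩
  let G : C(unitInterval × X, {z : ℂ // z ≠ 0}) := F.comp H'.toContinuousMap
  let cst : C(X, ℂ) := ContinuousMap.const X (Complex.log (f y))
  have h0 : ∀ a, G (0, a) = ⟨Complex.exp (cst a), Complex.exp_ne_zero _⟩ := by
    intro a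
    apply Subtype.ext
    simp [G, F, cst, Complex.exp_log (hf y)]
  let L := Complex.isCoveringMap_exp.liftHomotopy G cst h0
  refine ⟨⟨fun x => L (1, x), by fun_prop⟩, fun x => ?_⟩
  have := congrFun (Complex.isCoveringMap_exp.liftHomotopy_lifts G cst h0) (1, x)
  have h2 := congrArg Subtype.val this
  have h3 : (G (1, x) : ℂ) = f x := by simp [G, F]
  exact h2.trans h3

/-- No nonvanishing extension of `z - a` from the circle to the disc. -/
lemma no_retract (F : C(ℂ, ℂ)) (a : ℂ) (r : ℝ) (hr : 0 < r)
    (hF : ∀ z ∈ Metric.closedBall a r, F z ≠ 0)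
    (hS : ∀ z ∈ Metric.sphere a r, F z = z - a) : False := by
  have : ContractibleSpace (Metric.closedBall a r) :=
    (convex_closedBall a r).contractibleSpace ⟨a, Metric.mem_closedBall_self hr.le⟩
  obtain ⟨g, hg⟩ := exists_log (F.restrict (Metric.closedBall a r)) (fun x => hF x x.2)
  have hmem : ∀ t : ℝ, circleMap a r t ∈ Metric.closedBall a r :=
    fun t => circleMap_mem_closedBall a hr.le t
  let φ : ℝ → ℂ := fun t => g ⟨circleMap a r t, hmem t⟩ - t * Complex.I
  have hφc : Continuous φ := by
    have : Continuous (circleMap a r) := continuous_circleMap a r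
    have h2 : Continuous (fun t : ℝ => (⟨circleMap a r t, hmem t⟩ : Metric.closedBall a r)) :=
      Continuous.subtype_mk this _
    exact (g.continuous.comp h2).sub (by fun_prop)
  have hexp : ∀ t, Complex.exp (φ t) = r := by
    intro t
    have h1 := hg ⟨circleMap a r t, hmem t⟩
    simp only [ContinuousMap.restrict_apply] at h1
    rw [hS _ (circleMap_mem_sphere a hr.le t)] at h1
    simp only [φ]
    rw [Complex.exp_sub, h1, circleMap]
    have := Complex.exp_ne_zero (t * Complex.I)
    field_simp
    ring
  have := Complex.isCoveringMap_exp.const_of_comp hφc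
    (fun t t' => by apply Subtype.ext; simp [hexp]) 0 (2 * Real.pi)
  have h3 : circleMap a r (2 * Real.pi) = circleMap a r 0 := by
    simp [circleMap]
  simp only [φ, h3] at this
  have h4 : ((2 * Real.pi : ℝ) : ℂ) * Complex.I = 0 := by
    linear_combination this + (Complex.ofReal_zero) * Complex.I
  simp [Real.pi_ne_zero] at h4

/-- Extension of nonvanishing functions to a circle. -/
lemma ext_circle (P : Set ℂ) (hP : IsCompact P) (G : C(P, ℂ)) (c : ℂ) (ε : ℝ) (hε : 0 < ε)
    (hG : ∀ θ : P, (θ : ℂ) ∈ Metric.sphere c ε → G θ ≠ 0) :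
    ∃ g : C(ℂ, ℂ), (∀ z ∈ Metric.sphere c ε, g z ≠ 0) ∧
      ∀ θ : P, (θ : ℂ) ∈ Metric.sphere c ε → g θ = G θ := by
  obtain ⟨G', hG'⟩ := G.exists_restrict_eq hP.isClosed
  have hG'' : ∀ θ : P, G' θ = G θ := fun θ => by rw [← hG']; rfl
  have hK : IsCompact (P ∩ Metric.sphere c ε) := hP.inter_right Metric.isClosed_sphere
  obtain ⟨m, hm, hmle⟩ : ∃ m > 0, ∀ z ∈ P ∩ Metric.sphere c ε, m ≤ ‖G' z‖ := by
    rcases (P ∩ Metric.sphere c ε).eq_empty_or_nonempty with h | h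
    · exact ⟨1, one_pos, by simp [h]⟩
    · obtain ⟨z, hz, hmin⟩ := hK.exists_isMinOn h (G'.continuous.norm.continuousOn)
      refine ⟨‖G' z‖, ?_, fun y hy => hmin hy⟩
      rw [gt_iff_lt, norm_pos_iff, hG'' ⟨z, hz.1⟩]
      exact hG ⟨z, hz.1⟩ hz.2
  obtain ⟨g1, hg1, hg1d, -⟩ := G'.continuous.exists_contDiff_approx 1
    (ε := fun _ => m / 4) continuous_const (fun _ => by positivity)
  have hcd : ContDiff ℝ 1 (fun t : ℝ => g1 (circleMap c ε t)) :=
    ContDiff.comp (by exact_mod_cast hg1) (contDiff_circleMap c ε)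
  have hd := hcd.dense_compl_range_of_finrank_lt_finrank (by simp)
  obtain ⟨w, hw, hwm⟩ := Metric.dense_iff.1 hd 0 (m / 4) (by positivity)
  rw [mem_ball_zero_iff] at hw
  have hg2 : ∀ z ∈ Metric.sphere c ε, g1 z - w ≠ 0 := by
    intro z hz h0
    rw [← abs_of_pos hε, ← range_circleMap] at hz
    obtain ⟨t, rfl⟩ := hz
    exact hwm ⟨t, by simpa [sub_eq_zero] using h0⟩
  have hg1c : Continuous g1 := hg1.continuous
  have hslit : ∀ z ∈ P ∩ Metric.sphere c ε, (g1 z - w) / G' z ∈ Complex.slitPlane := by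
    intro z hz
    suffices hs : ‖(g1 z - w) / G' z - 1‖ < 1 by
      simpa using Complex.mem_slitPlane_of_norm_lt_one hs
    have hne : G' z ≠ 0 := by
      intro h0; have := hmle z hz; rw [h0] at this; simp at this; linarith
    have h1 := hmle z hz
    rw [div_sub_one hne, norm_div, div_lt_one (by positivity)]
    have h2 := hg1d z
    rw [dist_eq_norm] at h2
    calc ‖g1 z - w - G' z‖ = ‖(g1 z - G' z) - w‖ := by ring_nf
      _ ≤ ‖g1 z - G' z‖ + ‖w‖ := norm_sub_le _ _
      _ < ‖G' z‖ := by linarith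
  have hne' : ∀ z ∈ P ∩ Metric.sphere c ε, G' z ≠ 0 := by
    intro z hz h0; have := hmle z hz; rw [h0] at this; simp at this; linarith
  have hlc : ContinuousOn (fun z => Complex.log ((g1 z - w) / G' z)) (P ∩ Metric.sphere c ε) := by
    apply ContinuousOn.clog _ hslit
    exact ContinuousOn.div (by fun_prop) (by fun_prop) hne'
  obtain ⟨L, hL⟩ := ContinuousMap.exists_restrict_eq hK.isClosed
    (⟨_, hlc.domRestrict⟩ : C(↥(P ∩ Metric.sphere c ε), ℂ))
  refine ⟨⟨fun z => (g1 z - w) * Complex.exp (- L z), by fun_prop⟩, ?_, ?_⟩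
  · intro z hz
    exact mul_ne_zero (hg2 z hz) (Complex.exp_ne_zero _)
  · intro θ hθ
    have h1 := congrArg (fun f => f ⟨θ, θ.2, hθ⟩) hL
    simp only [ContinuousMap.restrict_apply, ContinuousMap.coe_mk, Set.domRestrict_apply] at h1
    simp only [ContinuousMap.coe_mk]
    have h2 := hne' θ ⟨θ.2, hθ⟩
    have h3 := hg2 θ hθ
    rw [h1, Complex.exp_neg, Complex.exp_log (div_ne_zero h3 h2), ← hG'']
    field_simp

/-- planar invariance of domain, in the form needed -/
lemma interior_range_empty (P : Set ℂ) (hP : IsCompact P) (hint : interior P = ∅)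
    (h : C(P, ℂ)) (hinj : Function.Injective h) : interior (Set.range h) = ∅ := by
  have : CompactSpace P := isCompact_iff_compactSpace.1 hP
  have hemb : IsClosedEmbedding h := h.continuous.isClosedEmbedding hinj
  by_contra hne
  obtain ⟨a, ha⟩ := Set.nonempty_iff_ne_empty.2 hne
  obtain ⟨r, hr, hball⟩ := Metric.nhds_basis_closedBall.mem_iff.1 (mem_interior_iff_mem_nhds.1 ha)
  obtain ⟨θ0, hθ0⟩ := interior_subset ha
  obtain ⟨η, hη, hηb⟩ := Metric.continuous_iff.1 h.continuous θ0 r hr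
  set ε := η / 2 with hε
  have hε0 : 0 < ε := by positivity
  obtain ⟨c, hcP, hcd⟩ : ∃ c, c ∉ P ∧ dist c θ0 < ε := by
    by_contra hcon
    push Not at hcon
    have : (θ0 : ℂ) ∈ interior P := by
      rw [mem_interior_iff_mem_nhds, Metric.mem_nhds_iff]
      refine ⟨ε, hε0, fun z hz => ?_⟩
      by_contra hz'
      exact absurd (hcon z hz') (not_le.2 hz)
    rw [hint] at this
    exact this
  let G : C(P, ℂ) := ⟨fun θ => h θ - a, by fun_prop⟩
  have hG0 : ∀ θ : P, ε ≤ dist (θ : ℂ) c → G θ ≠ 0 := by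
    intro θ hθ h0
    have : h θ = h θ0 := by
      simp only [G, ContinuousMap.coe_mk, sub_eq_zero] at h0
      rw [h0, hθ0]
    rw [hinj this, dist_comm] at hθ
    linarith
  obtain ⟨g, hg0, hgG⟩ := ext_circle P hP G c ε hε0 (fun θ hθ => hG0 θ (by
    rw [Metric.mem_sphere] at hθ; exact hθ.ge))
  have hpc : ∀ θ : P, ‖(θ : ℂ) - c‖ ≠ 0 := by
    intro θ h0
    rw [norm_eq_zero, sub_eq_zero] at h0
    exact hcP (h0 ▸ θ.2)
  let Φ : P → ℂ := fun θ => c + ((ε / ‖(θ : ℂ) - c‖ : ℝ) : ℂ) * (θ - c)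
  have hΦ : Continuous Φ := by
    have : Continuous fun θ : P => ε / ‖(θ : ℂ) - c‖ :=
      Continuous.div (by fun_prop) (by fun_prop) hpc
    fun_prop
  have hΦS : ∀ θ, Φ θ ∈ Metric.sphere c ε := by
    intro θ
    have := hpc θ
    rw [mem_sphere_iff_norm]
    simp only [Φ, add_sub_cancel_left, norm_mul, Complex.norm_real, norm_div, norm_norm,
      Real.norm_of_nonneg hε0.le]
    field_simp
  let Gt : P → ℂ := fun θ => if ε ≤ ‖(θ : ℂ) - c‖ then G θ else g (Φ θ)
  have hGt : Continuous Gt := by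
    refine Continuous.if_le G.continuous (g.continuous.comp hΦ) continuous_const (by fun_prop) ?_
    intro θ hθ
    have h1 : Φ θ = θ := by
      simp only [Φ]
      rw [← hθ, div_self hε0.ne']
      simp
    rw [h1, hgG θ (by rw [mem_sphere_iff_norm, ← hθ])]
  have hGt0 : ∀ θ, Gt θ ≠ 0 := by
    intro θ
    simp only [Gt]
    split_ifs with hc
    · exact hG0 θ (by rwa [dist_eq_norm])
    · exact hg0 _ (hΦS θ)
  obtain ⟨F, hF⟩ := ContinuousMap.exists_extension' hemb ⟨Gt, hGt⟩
  have hF' : ∀ θ, F (h θ) = Gt θ := fun θ => congrFun hF θ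
  refine no_retract F a r hr ?_ ?_
  · intro z hz
    obtain ⟨θ, rfl⟩ := hball hz
    rw [hF']; exact hGt0 θ
  · intro z hz
    obtain ⟨θ, rfl⟩ := hball (Metric.sphere_subset_closedBall hz)
    rw [hF']
    simp only [Gt]
    rw [if_pos]
    · rfl
    · by_contra hlt
      push Not at hlt
      rw [← dist_eq_norm] at hlt
      have : dist θ θ0 < η := by
        rw [Subtype.dist_eq]
        have := dist_triangle (θ : ℂ) c θ0
        linarith
      have := hηb θ this
      rw [hθ0] at this
      rw [Metric.mem_sphere] at hz
      linarith

/-- the complement of an embedded contractible compact has no bounded clopen part -/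
lemma no_bounded_part {X : Type*} [TopologicalSpace X] [CompactSpace X] [ContractibleSpace X]
    (h : C(X, ℂ)) (hinj : Function.Injective h) (U : Set ℂ) (hU : IsOpen U)
    (hUK : Disjoint U (Set.range h)) (hV : IsOpen (U ∪ Set.range h)ᶜ)
    (hb : Bornology.IsBounded U) : U = ∅ := by
  have hemb : IsClosedEmbedding h := h.continuous.isClosedEmbedding hinj
  by_contra hne
  obtain ⟨a, ha⟩ := Set.nonempty_iff_ne_empty.2 hne
  obtain ⟨L, hL⟩ := exists_log (⟨fun x => h x - a, by fun_prop⟩ : C(X, ℂ)) (by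
    intro x h0
    simp only [ContinuousMap.coe_mk, sub_eq_zero] at h0
    exact Set.disjoint_left.1 hUK ha ⟨x, h0⟩)
  obtain ⟨L', hL'⟩ := ContinuousMap.exists_extension' hemb L
  classical
  have hcont : Continuous (fun z => if z ∈ U then Complex.exp (L' z) else z - a) := by
    refine Continuous.if ?_ (by fun_prop) (by fun_prop)
    intro z hz
    have hz' : z ∈ frontier U := hz
    have hzK : z ∈ Set.range h := by
      by_contra hzK
      rw [hU.frontier_eq] at hz'
      have : z ∈ (U ∪ Set.range h)ᶜ := by simp [hz'.2]; simpa using hzK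
      obtain ⟨y, hy1, hy2⟩ := mem_closure_iff.1 hz'.1 _ hV this
      exact hy1 (Or.inl hy2)
    obtain ⟨x, rfl⟩ := hzK
    have : L' (h x) = L x := congrFun hL' x
    rw [this, hL]; rfl
  obtain ⟨R, hR⟩ := hb.subset_ball a
  refine no_retract ⟨_, hcont⟩ a (max R 1) (by positivity) ?_ ?_
  · intro z _
    simp only [ContinuousMap.coe_mk]
    split_ifs with hz
    · exact Complex.exp_ne_zero _
    · rw [sub_ne_zero]; rintro rfl; exact hz ha
  · intro z hz
    simp only [ContinuousMap.coe_mk]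
    rw [if_neg]
    intro hzU
    have h1 := hR hzU
    rw [Metric.mem_ball] at h1
    rw [Metric.mem_sphere] at hz
    have := le_max_left R 1
    linarith

end EnsReach

namespace EnsReach

open Topology

section alg
variable {X : Type*} [TopologicalSpace X] [CompactSpace X]

lemma holo_mem (𝒜 : Subalgebra ℂ C(X, ℂ)) (hcl : IsClosed (𝒜 : Set C(X, ℂ)))
    (u v : C(X, ℂ)) (hu : u ∈ 𝒜) (φ : ℂ → ℂ) (hφ : DifferentiableOn ℂ φ (Metric.ball 0 1))
    (hur : ∀ x, ‖u x‖ ≤ 1 / 4) (hv : ∀ x, v x = φ (u x)) : v ∈ 𝒜 := by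
  have h34 : (0 : NNReal) < 3 / 4 := by positivity
  have hps := (hφ.mono (Metric.closedBall_subset_ball (ε₁ := ((3 / 4 : NNReal) : ℝ)) (by
    push_cast; norm_num))).hasFPowerSeriesOnBall h34
  have htu := hps.tendstoUniformlyOn (r' := 1 / 2) (by
    rw [ENNReal.coe_lt_coe, ← NNReal.coe_lt_coe]; push_cast; norm_num)
  rw [Metric.tendstoUniformlyOn_iff] at htu
  have : v ∈ closure (𝒜 : Set C(X, ℂ)) := by
    rw [Metric.mem_closure_iff]
    intro ε hε
    obtain ⟨n, hn⟩ := (htu (ε / 2) (by positivity)).exists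
    let p := cauchyPowerSeries φ 0 ((3 / 4 : NNReal) : ℝ)
    refine ⟨∑ k ∈ Finset.range n, (p.coeff k) • u ^ k, ?_, ?_⟩
    · exact Subalgebra.sum_mem _ fun k _ => Subalgebra.smul_mem _ (Subalgebra.pow_mem _ hu k) _
    · refine lt_of_le_of_lt ((ContinuousMap.dist_le (C := ε / 2) (by positivity)).2 ?_) (by linarith)
      intro x
      have h1 := hn (u x) (by
        rw [mem_ball_zero_iff]; push_cast; exact lt_of_le_of_lt (hur x) (by norm_num))
      rw [zero_add] at h1
      rw [hv]
      refine le_of_eq_of_le ?_ h1.le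
      congr 1
      simp [FormalMultilinearSeries.partialSum, p, mul_comm]
  rwa [hcl.closure_eq] at this

variable (𝒜 : Subalgebra ℂ C(X, ℂ)) (h : C(X, ℂ))

/-- `h - q` is invertible in the algebra -/
def Inv (q : ℂ) : Prop := ∃ v ∈ 𝒜, ∀ x, v x * (h x - q) = 1

lemma inv_step (hcl : IsClosed (𝒜 : Set C(X, ℂ))) (q q' : ℂ) (d : ℝ) (hd : 0 < d)
    (hdq : ∀ x, d ≤ ‖h x - q‖) (hq : Inv 𝒜 h q) (hqq : ‖q' - q‖ ≤ d / 4) :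
    Inv 𝒜 h q' ∧ ∃ σ ∈ 𝒜, ∀ x, (σ x) ^ 2 * (h x - q) = h x - q' ∧ 0 < (σ x).re := by
  obtain ⟨v, hv, hv1⟩ := hq
  let u : C(X, ℂ) := (q' - q) • v
  have hu : u ∈ 𝒜 := Subalgebra.smul_mem _ hv _
  have hur : ∀ x, ‖u x‖ ≤ 1 / 4 := by
    intro x
    have h1 : ‖v x‖ * ‖h x - q‖ = 1 := by rw [← norm_mul, hv1, norm_one]
    have h2 : ‖v x‖ * d ≤ 1 := by
      rw [← h1]; exact mul_le_mul_of_nonneg_left (hdq x) (norm_nonneg _)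
    have h3 : ‖u x‖ = ‖q' - q‖ * ‖v x‖ := by simp [u]
    rw [h3]
    nlinarith [norm_nonneg (v x)]
  have hslit : ∀ w : ℂ, ‖w‖ < 1 → 1 - w ∈ Complex.slitPlane := by
    intro w hw
    rw [sub_eq_add_neg]
    exact Complex.mem_slitPlane_of_norm_lt_one (by simpa using hw)
  have hslitu : ∀ x, 1 - u x ∈ Complex.slitPlane :=
    fun x => hslit _ (lt_of_le_of_lt (hur x) (by norm_num))
  have hu1 : ∀ x, (1 - u x) * (h x - q) = h x - q' := by
    intro x
    have : u x = (q' - q) * v x := by simp [u]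
    rw [this]
    linear_combination (-(q' - q)) * hv1 x
  constructor
  · have hne : ∀ x, 1 - u x ≠ 0 := fun x => Complex.slitPlane_ne_zero (hslitu x)
    let w : C(X, ℂ) := ⟨fun x => (1 - u x)⁻¹, Continuous.inv₀ (by fun_prop) hne⟩
    have hw : w ∈ 𝒜 := holo_mem 𝒜 hcl u w hu (fun z => (1 - z)⁻¹) (by
      intro z hz
      have := Complex.slitPlane_ne_zero (hslit z (by simpa using hz))
      exact (DifferentiableAt.inv (by fun_prop) this).differentiableWithinAt) hur (fun x => rfl)
    refine ⟨w * v, Subalgebra.mul_mem _ hw hv, fun x => ?_⟩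
    have : w x * (1 - u x) = 1 := inv_mul_cancel₀ (hne x)
    simp only [ContinuousMap.mul_apply]
    rw [← hu1]
    linear_combination (v x * (h x - q)) * this + hv1 x
  · let σ : C(X, ℂ) := ⟨fun x => Complex.exp (Complex.log (1 - u x) / 2), by
      have : Continuous fun x => Complex.log (1 - u x) := Continuous.clog (by fun_prop) hslitu
      fun_prop⟩
    refine ⟨σ, ?_, fun x => ⟨?_, ?_⟩⟩
    · refine holo_mem 𝒜 hcl u σ hu (fun z => Complex.exp (Complex.log (1 - z) / 2)) ?_ hur
        (fun x => rfl)
      intro z hz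
      have := hslit z (by simpa using hz)
      have h1 : DifferentiableAt ℂ (fun z => Complex.log (1 - z)) z :=
        DifferentiableAt.clog (by fun_prop) this
      exact (by fun_prop : DifferentiableAt ℂ
        (fun z => Complex.exp (Complex.log (1 - z) / 2)) z).differentiableWithinAt
    · have : σ x ^ 2 = 1 - u x := by
        simp only [σ, ContinuousMap.coe_mk]
        rw [← Complex.exp_nat_mul]
        push_cast
        rw [mul_div_cancel₀ _ (two_ne_zero), Complex.exp_log (Complex.slitPlane_ne_zero (hslitu x))]
      rw [this, hu1]
    · simp only [σ, ContinuousMap.coe_mk, Complex.exp_re]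
      apply mul_pos (Real.exp_pos _)
      have h1 : (Complex.log (1 - u x) / 2).im = Complex.arg (1 - u x) / 2 := by
        have : (Complex.log (1 - u x) / 2) = ((1 / 2 : ℝ) : ℂ) * Complex.log (1 - u x) := by
          push_cast; ring
        rw [this, Complex.im_ofReal_mul, Complex.log_im]; ring
      rw [h1]
      have h2 := Complex.neg_pi_lt_arg (1 - u x)
      have h3 := Complex.arg_le_pi (1 - u x)
      have h4 : Complex.arg (1 - u x) ≠ Real.pi := (Complex.mem_slitPlane_iff_arg.1 (hslitu x)).1
      have h5 := lt_of_le_of_ne h3 h4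
      exact Real.cos_pos_of_mem_Ioo ⟨by linarith, by linarith⟩

lemma exists_dist_pos (q : ℂ) (hq : q ∉ Set.range h) : ∃ d > 0, ∀ x, d ≤ ‖h x - q‖ := by
  have hc : IsClosed (Set.range h) := (isCompact_range h.continuous).isClosed
  obtain ⟨d, hd, hb⟩ := Metric.isOpen_iff.1 hc.isOpen_compl q hq
  refine ⟨d, hd, fun x => ?_⟩
  by_contra hlt
  push Not at hlt
  exact hb (by rwa [Metric.mem_ball, dist_eq_norm]) ⟨x, rfl⟩

lemma inv_all [ContractibleSpace X] (hinj : Function.Injective h)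
    (hcl : IsClosed (𝒜 : Set C(X, ℂ))) (hh : h ∈ 𝒜) (q : ℂ) (hq : q ∉ Set.range h) :
    Inv 𝒜 h q := by
  by_contra hcon
  have key : ∀ q, q ∉ Set.range h → ∃ r > 0, ∀ q', ‖q' - q‖ < r → 
      q' ∉ Set.range h ∧ (Inv 𝒜 h q ↔ Inv 𝒜 h q') := by
    intro q hq
    obtain ⟨d, hd, hdq⟩ := exists_dist_pos h q hq
    refine ⟨d / 8, by positivity, fun q' hq' => ?_⟩
    have hdq' : ∀ x, d / 2 ≤ ‖h x - q'‖ := by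
      intro x
      have h1 := hdq x
      have h2 : ‖h x - q‖ ≤ ‖h x - q'‖ + ‖q' - q‖ := norm_sub_le_norm_sub_add_norm_sub _ _ _
      linarith
    refine ⟨?_, ?_, ?_⟩
    · rintro ⟨x, rfl⟩
      have := hdq' x
      simp at this
      linarith
    · intro hI
      exact (inv_step 𝒜 h hcl q q' d hd hdq hI (by linarith)).1
    · intro hI
      exact (inv_step 𝒜 h hcl q' q (d / 2) (by positivity) hdq' hI (by
        rw [norm_sub_rev]; linarith)).1
  have : {q | q ∉ Set.range h ∧ ¬ Inv 𝒜 h q} = ∅ := by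
    apply no_bounded_part h hinj
    · rw [Metric.isOpen_iff]
      rintro q ⟨hq, hI⟩
      obtain ⟨r, hr, hb⟩ := key q hq
      refine ⟨r, hr, fun q' hq' => ?_⟩
      rw [Metric.mem_ball, dist_eq_norm] at hq'
      exact ⟨(hb q' hq').1, fun h' => hI ((hb q' hq').2.2 h')⟩
    · rw [Set.disjoint_left]
      rintro q ⟨hq, -⟩
      exact hq
    · rw [Metric.isOpen_iff]
      intro q hq
      simp only [Set.mem_compl_iff, Set.mem_union, Set.mem_setOf_eq, not_or, not_and, not_not] at hq
      obtain ⟨r, hr, hb⟩ := key q hq.2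
      refine ⟨r, hr, fun q' hq' => ?_⟩
      rw [Metric.mem_ball, dist_eq_norm] at hq'
      simp only [Set.mem_compl_iff, Set.mem_union, Set.mem_setOf_eq, not_or, not_and, not_not]
      exact ⟨fun _ => (hb q' hq').2.1 (hq.1 hq.2), (hb q' hq').1⟩
    · rw [isBounded_iff_forall_norm_le]
      refine ⟨4 * ‖h‖ + 1, ?_⟩
      rintro q ⟨hq, hI⟩
      by_contra hlt
      push Not at hlt
      apply hI
      have hq0 : q ≠ 0 := by
        rintro rfl
        rw [norm_zero] at hlt
        linarith [norm_nonneg h]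
      have hqp : 0 < ‖q‖ := norm_pos_iff.2 hq0
      have hne : ∀ x, h x - q ≠ 0 := fun x h0 => hq ⟨x, sub_eq_zero.1 h0⟩
      let v : C(X, ℂ) := ⟨fun x => (h x - q)⁻¹, Continuous.inv₀ (by fun_prop) hne⟩
      refine ⟨v, ?_, fun x => inv_mul_cancel₀ (hne x)⟩
      refine holo_mem 𝒜 hcl (q⁻¹ • h) v (Subalgebra.smul_mem _ hh _)
        (fun w => (q * w - q)⁻¹) ?_ ?_ ?_
      · intro z hz
        have : q * z - q ≠ 0 := by
          intro h0
          have : q * (z - 1) = 0 := by linear_combination h0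
          rcases mul_eq_zero.1 this with h1 | h1
          · exact hq0 h1
          · rw [sub_eq_zero] at h1
            simp [h1] at hz
        have hd : DifferentiableAt ℂ (fun w : ℂ => q * w - q) z := by fun_prop
        exact (hd.inv this).differentiableWithinAt
      · intro x
        have := h.norm_coe_le_norm x
        simp only [ContinuousMap.smul_apply, smul_eq_mul, norm_mul, norm_inv]
        rw [inv_mul_le_iff₀ hqp]
        linarith
      · intro x
        simp only [v, ContinuousMap.coe_mk, ContinuousMap.smul_apply, smul_eq_mul]
        rw [mul_inv_cancel_left₀ hq0]
  exact (this ▸ (⟨hq, hcon⟩ : q ∈ {q | q ∉ Set.range h ∧ ¬ Inv 𝒜 h q}) : q ∈ (∅ : Set ℂ))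

lemma cone (a b : ℂ) (ha : 0 < a.re) (hb : 0 < b.re) (ha2 : 0 < (a ^ 2).re) (hb2 : 0 < (b ^ 2).re) :
    0 < (a * b).re := by
  simp only [pow_two, Complex.mul_re] at *
  have h1 : |a.im| < a.re := abs_lt_of_sq_lt_sq (by nlinarith) ha.le
  have h2 : |b.im| < b.re := abs_lt_of_sq_lt_sq (by nlinarith) hb.le
  have h3 : a.im * b.im ≤ |a.im| * |b.im| := by rw [← abs_mul]; exact le_abs_self _
  have h4 : |a.im| * |b.im| < a.re * b.re := by
    apply mul_lt_mul'' h1 h2 (abs_nonneg _) (abs_nonneg _)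
  linarith

lemma re_pos_far (w z p q ζ : ℂ) (δ : ℝ) (hp : ‖p - ζ‖ < δ) (hq : ‖q - ζ‖ < δ)
    (hz : 3 * δ ≤ ‖z - ζ‖) (hw : w * (z - q) = z - p) : 0 < w.re := by
  have hδ : 0 < δ := lt_of_le_of_lt (norm_nonneg _) hp
  have h1 : ‖z - ζ‖ ≤ ‖z - q‖ + ‖q - ζ‖ := norm_sub_le_norm_sub_add_norm_sub _ _ _
  have h2 : ‖q - p‖ ≤ ‖q - ζ‖ + ‖ζ - p‖ := norm_sub_le_norm_sub_add_norm_sub _ _ _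
  rw [norm_sub_rev ζ p] at h2
  have h3 : ‖w - 1‖ * ‖z - q‖ = ‖q - p‖ := by
    rw [← norm_mul]; congr 1; linear_combination hw
  have h4 : ‖w - 1‖ < 1 := by
    by_contra hc
    push Not at hc
    nlinarith [norm_nonneg (z - q)]
  have h5 := Complex.abs_re_le_norm (w - 1)
  have h6 : (w - 1).re = w.re - 1 := by simp
  rw [h6] at h5
  have := neg_abs_le (w.re - 1)
  linarith

/-- existence of the square root of `(h - p)/(h - q)` with the right branch far away -/
def Sq (p ζ : ℂ) (δ : ℝ) (q : ℂ) : Prop :=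
  ∃ s ∈ 𝒜, ∀ x, (s x) ^ 2 * (h x - q) = h x - p ∧ (3 * δ ≤ ‖h x - ζ‖ → 0 < (s x).re)

lemma sq_step (hcl : IsClosed (𝒜 : Set C(X, ℂ))) (p ζ : ℂ) (δ : ℝ) (hp : ‖p - ζ‖ < δ) (q q' : ℂ)
    (hq : ‖q - ζ‖ < δ) (hq' : ‖q' - ζ‖ < δ)
    (d : ℝ) (hd : 0 < d) (hdq : ∀ x, d ≤ ‖h x - q'‖) (hI : Inv 𝒜 h q') (hqq : ‖q - q'‖ ≤ d / 4)
    (hS : Sq 𝒜 h p ζ δ q) : Sq 𝒜 h p ζ δ q' := by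
  obtain ⟨s, hs, hs1⟩ := hS
  obtain ⟨-, σ, hσ, hσ1⟩ := inv_step 𝒜 h hcl q' q d hd hdq hI hqq
  refine ⟨s * σ, Subalgebra.mul_mem _ hs hσ, fun x => ⟨?_, fun hx => ?_⟩⟩
  · simp only [ContinuousMap.mul_apply]
    linear_combination (s x) ^ 2 * (hσ1 x).1 + (hs1 x).1
  · simp only [ContinuousMap.mul_apply]
    exact cone _ _ ((hs1 x).2 hx) (hσ1 x).2
      (re_pos_far _ _ _ _ _ _ hp hq hx (hs1 x).1) (re_pos_far _ _ _ _ _ _ hq hq' hx (hσ1 x).1)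

lemma exists_sq [ContractibleSpace X] (hinj : Function.Injective h)
    (hcl : IsClosed (𝒜 : Set C(X, ℂ))) (hh : h ∈ 𝒜) (p ζ : ℂ) (δ : ℝ) (hp : ‖p - ζ‖ < δ / 4)
    (hpK : p ∉ Set.range h) : ∃ q, ‖q - ζ‖ < δ ∧ δ / 2 < ‖q - ζ‖ ∧ Sq 𝒜 h p ζ δ q := by
  by_contra hcon
  push Not at hcon
  have hδ : 0 < δ := by linarith [norm_nonneg (p - ζ)]
  have hp' : ‖p - ζ‖ < δ := by linarith
  have hcon' : ∀ q, ‖q - ζ‖ < δ → Sq 𝒜 h p ζ δ q → ‖q - ζ‖ ≤ δ / 2 := by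
    intro q hq hS
    by_contra hlt
    push Not at hlt
    exact hcon q hq hlt hS
  have key : ∀ q, q ∉ Set.range h → ‖q - ζ‖ < δ → ∃ r > 0, ∀ q', ‖q' - q‖ < r → 
      q' ∉ Set.range h ∧ ‖q' - ζ‖ < δ ∧ (Sq 𝒜 h p ζ δ q ↔ Sq 𝒜 h p ζ δ q') := by
    intro q hq hqδ
    obtain ⟨d, hd, hdq⟩ := exists_dist_pos h q hq
    refine ⟨min (d / 8) (δ - ‖q - ζ‖), by
      have : 0 < δ - ‖q - ζ‖ := by linarith
      positivity, fun q' hq' => ?_⟩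
    have hq'd : ‖q' - q‖ < d / 8 := lt_of_lt_of_le hq' (min_le_left _ _)
    have hq'δ : ‖q' - q‖ < δ - ‖q - ζ‖ := lt_of_lt_of_le hq' (min_le_right _ _)
    have hdq' : ∀ x, d / 2 ≤ ‖h x - q'‖ := by
      intro x
      have h1 := hdq x
      have h2 : ‖h x - q‖ ≤ ‖h x - q'‖ + ‖q' - q‖ := norm_sub_le_norm_sub_add_norm_sub _ _ _
      linarith
    have hq'K : q' ∉ Set.range h := by
      rintro ⟨x, rfl⟩
      have := hdq' x
      simp at this
      linarith
    have hq'b : ‖q' - ζ‖ < δ := by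
      have : ‖q' - ζ‖ ≤ ‖q' - q‖ + ‖q - ζ‖ := norm_sub_le_norm_sub_add_norm_sub _ _ _
      linarith
    refine ⟨hq'K, hq'b, ?_, ?_⟩
    · intro hI
      exact sq_step 𝒜 h hcl p ζ δ hp' q q' hqδ hq'b (d / 2) (by positivity) hdq' 
        (inv_all 𝒜 h hinj hcl hh q' hq'K) (by rw [norm_sub_rev]; linarith) hI
    · intro hI
      exact sq_step 𝒜 h hcl p ζ δ hp' q' q hq'b hqδ d (by positivity) hdq
        (inv_all 𝒜 h hinj hcl hh q hq) (by linarith) hI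
  have : {q | q ∉ Set.range h ∧ ‖q - ζ‖ < δ ∧ Sq 𝒜 h p ζ δ q} = ∅ := by
    apply no_bounded_part h hinj
    · rw [Metric.isOpen_iff]
      rintro q ⟨hq, hqδ, hI⟩
      obtain ⟨r, hr, hb⟩ := key q hq hqδ
      refine ⟨r, hr, fun q' hq' => ?_⟩
      rw [Metric.mem_ball, dist_eq_norm] at hq'
      exact ⟨(hb q' hq').1, (hb q' hq').2.1, (hb q' hq').2.2.1 hI⟩
    · rw [Set.disjoint_left]
      rintro q ⟨hq, -⟩
      exact hq
    · have hKc : IsOpen (Set.range h)ᶜ := (isCompact_range h.continuous).isClosed.isOpen_compl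
      rw [isOpen_iff_mem_nhds]
      intro q hq
      simp only [Set.mem_compl_iff, Set.mem_union, Set.mem_setOf_eq, not_or, not_and] at hq
      by_cases hqδ : ‖q - ζ‖ < δ
      · obtain ⟨r, hr, hb⟩ := key q hq.2 hqδ
        rw [Metric.mem_nhds_iff]
        refine ⟨r, hr, fun q' hq' => ?_⟩
        rw [Metric.mem_ball, dist_eq_norm] at hq'
        simp only [Set.mem_compl_iff, Set.mem_union, Set.mem_setOf_eq, not_or, not_and]
        exact ⟨fun _ _ hS => hq.1 hq.2 hqδ ((hb q' hq').2.2.2 hS), (hb q' hq').1⟩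
      · have ho : IsOpen {y : ℂ | δ / 2 < ‖y - ζ‖} :=
          isOpen_lt continuous_const (by fun_prop)
        have hm : q ∈ {y : ℂ | δ / 2 < ‖y - ζ‖} := by
          simp only [Set.mem_setOf_eq]; linarith
        filter_upwards [ho.mem_nhds hm, hKc.mem_nhds hq.2] with y hy1 hy2
        simp only [Set.mem_compl_iff, Set.mem_union, Set.mem_setOf_eq, not_or, not_and]
        exact ⟨fun _ hyδ hS => absurd (hcon' y hyδ hS) (not_le.2 hy1), hy2⟩
    · refine Metric.isBounded_ball (x := ζ) (r := δ) |>.subset ?_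
      rintro q ⟨-, hq, -⟩
      rwa [Metric.mem_ball, dist_eq_norm]
  have hpm : p ∈ {q | q ∉ Set.range h ∧ ‖q - ζ‖ < δ ∧ Sq 𝒜 h p ζ δ q} := by
    refine ⟨hpK, hp', 1, Subalgebra.one_mem _, fun x => ⟨by simp, fun _ => by simp⟩⟩
  exact (this ▸ hpm : p ∈ (∅ : Set ℂ))

lemma num_far (z p q ζ ζ' s : ℂ) (δ : ℝ) (hp : ‖p - ζ‖ < δ) (hq : ‖q - ζ‖ < δ)
    (hζ : ‖ζ' - ζ‖ < δ) (hpq : p ≠ q) (hs : s ^ 2 * (z - q) = z - p) (hz : 3 * δ ≤ ‖z - ζ‖)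
    (hre : 0 < s.re) :
    ‖8 / (p - q) ^ 2 * ((z - q) - (p - q) / 2 - (z - q) * s) - (z - ζ')⁻¹‖ ≤
      28 * δ / ‖z - ζ'‖ ^ 2 := by
  have hδ : 0 < δ := lt_of_le_of_lt (norm_nonneg _) hp
  have h1 : ‖z - ζ‖ ≤ ‖z - q‖ + ‖q - ζ‖ := norm_sub_le_norm_sub_add_norm_sub _ _ _
  have h2 : ‖z - ζ‖ ≤ ‖z - ζ'‖ + ‖ζ' - ζ‖ := norm_sub_le_norm_sub_add_norm_sub _ _ _
  have h3 : ‖z - ζ'‖ ≤ ‖z - ζ‖ + ‖ζ - ζ'‖ := norm_sub_le_norm_sub_add_norm_sub _ _ _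
  have h4 : ‖p - q‖ ≤ ‖p - ζ‖ + ‖ζ - q‖ := norm_sub_le_norm_sub_add_norm_sub _ _ _
  have h5 : ‖q - ζ'‖ ≤ ‖q - ζ‖ + ‖ζ - ζ'‖ := norm_sub_le_norm_sub_add_norm_sub _ _ _
  rw [norm_sub_rev ζ ζ'] at h3 h5
  rw [norm_sub_rev ζ q] at h4
  set ρ := ‖z - ζ'‖ with hρ
  have hρ0 : 0 < ρ := by linarith
  have hx : ρ / 2 ≤ ‖z - q‖ := by linarith
  have hx0 : z - q ≠ 0 := norm_pos_iff.1 (by linarith)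
  have hζ0 : z - ζ' ≠ 0 := norm_pos_iff.1 hρ0
  have hs1 : 1 ≤ ‖1 + s‖ := by
    have := Complex.re_le_norm (1 + s)
    simp at this
    linarith
  have hs0 : 1 + s ≠ 0 := norm_pos_iff.1 (by linarith)
  have he : p - q ≠ 0 := sub_ne_zero.2 hpq
  have hid : (p - q) = (1 - s) * (1 + s) * (z - q) := by linear_combination hs
  have h1s : 1 - s ≠ 0 := by
    intro h0; rw [h0] at hid; simp at hid; exact he hid
  have hf : 8 / (p - q) ^ 2 * ((z - q) - (p - q) / 2 - (z - q) * s) - (z - q)⁻¹ =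
      (p - q) * (3 + s) / ((z - q) ^ 2 * (1 + s) ^ 3) := by
    rw [hid]
    field_simp
    ring
  have hA : ‖8 / (p - q) ^ 2 * ((z - q) - (p - q) / 2 - (z - q) * s) - (z - q)⁻¹‖ ≤
      24 * δ / ρ ^ 2 := by
    rw [hf, norm_div, norm_mul, norm_mul, norm_pow, norm_pow, div_le_div_iff₀ (by positivity)
      (by positivity)]
    have h3s : ‖3 + s‖ ≤ 3 * ‖1 + s‖ ^ 3 := by
      have : ‖3 + s‖ ≤ 2 + ‖1 + s‖ := by
        have := norm_add_le (2 : ℂ) (1 + s)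
        rw [show (2 : ℂ) + (1 + s) = 3 + s by ring] at this
        simpa using this
      nlinarith [pow_le_pow_right₀ hs1 (show 1 ≤ 3 by norm_num), one_le_pow₀ hs1 (n := 3)]
    have h4δ : ‖p - q‖ ≤ 2 * δ := by linarith
    have hρx : ρ ^ 2 ≤ 4 * ‖z - q‖ ^ 2 := by nlinarith
    calc ‖p - q‖ * ‖3 + s‖ * ρ ^ 2 ≤ (2 * δ) * (3 * ‖1 + s‖ ^ 3) * (4 * ‖z - q‖ ^ 2) := by gcongr
      _ = 24 * δ * (‖z - q‖ ^ 2 * ‖1 + s‖ ^ 3) := by ring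
  have hB : ‖(z - q)⁻¹ - (z - ζ')⁻¹‖ ≤ 4 * δ / ρ ^ 2 := by
    have : (z - q)⁻¹ - (z - ζ')⁻¹ = (q - ζ') / ((z - q) * (z - ζ')) := by
      field_simp; ring
    rw [this, norm_div, norm_mul, div_le_div_iff₀ (by positivity) (by positivity), ← hρ]
    have h6 : ‖q - ζ'‖ ≤ 2 * δ := by linarith
    calc ‖q - ζ'‖ * ρ ^ 2 ≤ (2 * δ) * (2 * ‖z - q‖ * ρ) := by
          gcongr; nlinarith
      _ = _ := by ring
  have := norm_sub_le_norm_sub_add_norm_sub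
    (8 / (p - q) ^ 2 * ((z - q) - (p - q) / 2 - (z - q) * s)) ((z - q)⁻¹) ((z - ζ')⁻¹)
  calc _ ≤ _ := this
    _ ≤ 24 * δ / ρ ^ 2 + 4 * δ / ρ ^ 2 := add_le_add hA hB
    _ = _ := by ring

lemma num_near (z p q ζ ζ' s : ℂ) (δ : ℝ) (hp : ‖p - ζ‖ < δ / 4) (hq : ‖q - ζ‖ < δ)
    (hq2 : δ / 2 < ‖q - ζ‖)
    (hζ : ‖ζ' - ζ‖ < δ) (hs : s ^ 2 * (z - q) = z - p) (hz : ‖z - ζ‖ ≤ 3 * δ)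
    (hz0 : z ≠ ζ') :
    ‖8 / (p - q) ^ 2 * ((z - q) - (p - q) / 2 - (z - q) * s) - (z - ζ')⁻¹‖ ≤
      4609 / ‖z - ζ'‖ ∧ ‖z - ζ'‖ ≤ 4 * δ := by
  have hδ : 0 < δ := lt_of_le_of_lt (norm_nonneg _) hq
  have h1 : ‖z - q‖ ≤ ‖z - ζ‖ + ‖ζ - q‖ := norm_sub_le_norm_sub_add_norm_sub _ _ _
  have h1p : ‖z - p‖ ≤ ‖z - ζ‖ + ‖ζ - p‖ := norm_sub_le_norm_sub_add_norm_sub _ _ _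
  have h3 : ‖z - ζ'‖ ≤ ‖z - ζ‖ + ‖ζ - ζ'‖ := norm_sub_le_norm_sub_add_norm_sub _ _ _
  have h4 : ‖p - q‖ ≤ ‖p - ζ‖ + ‖ζ - q‖ := norm_sub_le_norm_sub_add_norm_sub _ _ _
  have h5 : ‖q - ζ‖ ≤ ‖q - p‖ + ‖p - ζ‖ := norm_sub_le_norm_sub_add_norm_sub _ _ _
  rw [norm_sub_rev ζ ζ'] at h3
  rw [norm_sub_rev ζ q] at h4 h1
  rw [norm_sub_rev ζ p] at h1p
  rw [norm_sub_rev q p] at h5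
  have he : δ / 4 ≤ ‖p - q‖ := by linarith
  have he2 : (δ / 4) ^ 2 ≤ ‖p - q‖ ^ 2 := by gcongr
  have hρ : ‖z - ζ'‖ ≤ 4 * δ := by linarith
  have hρ0 : 0 < ‖z - ζ'‖ := norm_pos_iff.2 (sub_ne_zero.2 hz0)
  refine ⟨?_, hρ⟩
  have hxs : ‖(z - q) * s‖ ≤ 4 * δ := by
    have : ‖(z - q) * s‖ ^ 2 = ‖z - q‖ * ‖z - p‖ := by
      rw [← norm_pow, ← norm_mul]; congr 1; linear_combination (z - q) * hs
    have h6 : ‖(z - q) * s‖ ^ 2 ≤ (4 * δ) ^ 2 := by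
      rw [this, pow_two (4 * δ)]; gcongr <;> linarith
    exact le_of_sq_le_sq h6 (by positivity)
  have hw : ‖(z - q) - (p - q) / 2 - (z - q) * s‖ ≤ 9 * δ := by
    have ha := norm_sub_le ((z - q) - (p - q) / 2) ((z - q) * s)
    have hb := norm_sub_le (z - q) ((p - q) / 2)
    have hc : ‖(p - q) / 2‖ = ‖p - q‖ / 2 := by simp
    linarith
  have hF : ‖8 / (p - q) ^ 2 * ((z - q) - (p - q) / 2 - (z - q) * s)‖ ≤ 1152 / δ := by
    rw [norm_mul, norm_div, norm_pow]
    calc ‖(8 : ℂ)‖ / ‖p - q‖ ^ 2 * ‖(z - q) - (p - q) / 2 - (z - q) * s‖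
        ≤ 8 / (δ / 4) ^ 2 * (9 * δ) := by
          gcongr
          simp
      _ = 1152 / δ := by field_simp; norm_num
  have hF2 : 1152 / δ ≤ 4608 / ‖z - ζ'‖ := by
    rw [div_le_div_iff₀ hδ hρ0]; linarith
  have := norm_sub_le (8 / (p - q) ^ 2 * ((z - q) - (p - q) / 2 - (z - q) * s)) (z - ζ')⁻¹
  rw [norm_inv] at this
  calc _ ≤ _ := this
    _ ≤ 4608 / ‖z - ζ'‖ + ‖z - ζ'‖⁻¹ := by gcongr; exact hF.trans hF2
    _ = _ := by ring

lemma key_approx [ContractibleSpace X] (hinj : Function.Injective h)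
    (hcl : IsClosed (𝒜 : Set C(X, ℂ))) (hh : h ∈ 𝒜) (hint : interior (Set.range h) = ∅)
    (δ : ℝ) (hδ : 0 < δ) (ζ : ℂ) : ∃ f ∈ 𝒜, ∀ x, ∀ ζ', ‖ζ' - ζ‖ < δ → h x ≠ ζ' →
      ‖f x - (h x - ζ')⁻¹‖ ≤ 10000 * √δ * ‖h x - ζ'‖ ^ (-(3 / 2) : ℝ) := by
  obtain ⟨p, hpK, hp⟩ : ∃ p, p ∉ Set.range h ∧ ‖p - ζ‖ < δ / 4 := by
    by_contra hcon
    push Not at hcon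
    have : ζ ∈ interior (Set.range h) := by
      rw [mem_interior_iff_mem_nhds, Metric.mem_nhds_iff]
      refine ⟨δ / 4, by positivity, fun z hz => ?_⟩
      by_contra hz'
      rw [Metric.mem_ball, dist_eq_norm] at hz
      exact absurd (hcon z hz') (not_le.2 hz)
    rw [hint] at this
    exact this
  obtain ⟨q, hq, hq2, s, hs, hs1⟩ := exists_sq 𝒜 h hinj hcl hh p ζ δ hp hpK
  have hpq : p ≠ q := by rintro rfl; linarith
  have hconst : ∀ c : ℂ, ContinuousMap.const X c ∈ 𝒜 := fun c => 𝒜.algebraMap_mem c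
  refine ⟨(8 / (p - q) ^ 2) • ((h - ContinuousMap.const X q) - ContinuousMap.const X ((p - q) / 2)
    - (h - ContinuousMap.const X q) * s), ?_, ?_⟩
  · have h1 := 𝒜.sub_mem hh (hconst q)
    exact 𝒜.smul_mem (𝒜.sub_mem (𝒜.sub_mem h1 (hconst _)) (𝒜.mul_mem h1 hs)) _
  · intro x ζ' hζ' hne
    simp only [ContinuousMap.smul_apply, ContinuousMap.sub_apply, ContinuousMap.mul_apply,
      ContinuousMap.const_apply, smul_eq_mul]
    set ρ := ‖h x - ζ'‖ with hρ
    have hρ0 : 0 < ρ := norm_pos_iff.2 (sub_ne_zero.2 hne)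
    have hsp : 0 < √ρ := Real.sqrt_pos.2 hρ0
    have hsd : 0 < √δ := Real.sqrt_pos.2 hδ
    have hrp : ρ ^ (-(3 / 2) : ℝ) = 1 / (ρ * √ρ) := by
      rw [Real.rpow_neg hρ0.le, show (3 / 2 : ℝ) = 1 + 1 / 2 by norm_num, Real.rpow_add hρ0,
        Real.rpow_one, ← Real.sqrt_eq_rpow, one_div]
    have e1 : √ρ * √ρ = ρ := Real.mul_self_sqrt hρ0.le
    have e2 : √δ * √δ = δ := Real.mul_self_sqrt hδ.le
    rw [hrp]
    rcases le_total (3 * δ) ‖h x - ζ‖ with hfar | hnear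
    · refine (num_far (h x) p q ζ ζ' (s x) δ (by linarith) hq hζ' hpq (hs1 x).1 hfar
        ((hs1 x).2 hfar)).trans ?_
      rw [← hρ]
      have h2 : ‖h x - ζ‖ ≤ ‖h x - ζ'‖ + ‖ζ' - ζ‖ := norm_sub_le_norm_sub_add_norm_sub _ _ _
      have hle : √δ ≤ √ρ := Real.sqrt_le_sqrt (by linarith)
      calc 28 * δ / ρ ^ 2 = 28 * √δ * √δ / (ρ * √ρ * √ρ) := by
            rw [mul_assoc, mul_assoc, e1, e2, pow_two]
        _ ≤ 28 * √δ * √ρ / (ρ * √ρ * √ρ) := by gcongr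
        _ = 28 * √δ * (1 / (ρ * √ρ)) := by field_simp
        _ ≤ _ := by gcongr; norm_num
    · obtain ⟨h1, h2⟩ := num_near (h x) p q ζ ζ' (s x) δ hp hq hq2 hζ' (hs1 x).1 hnear hne
      refine h1.trans ?_
      rw [← hρ] at h2 ⊢
      have hle : √ρ ≤ 2 * √δ := by
        rw [Real.sqrt_le_left (by positivity)]; nlinarith
      calc 4609 / ρ = 4609 * √ρ * (1 / (ρ * √ρ)) := by field_simp
        _ ≤ 4609 * (2 * √δ) * (1 / (ρ * √ρ)) := by gcongr
        _ ≤ _ := by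
          rw [← mul_assoc]; gcongr; norm_num

end alg

end EnsReach

namespace EnsReach

open MeasureTheory Metric

/-- truncated Riesz kernel -/
noncomputable def KK (α R : ℝ) : ℂ → ℝ := Set.indicator (ball 0 (2 * R)) (fun w => ‖w‖ ^ (-α))

lemma KK_int (α R : ℝ) (hα : α < 2) : Integrable (KK α R) := by
  unfold KK
  rw [integrable_indicator_iff measurableSet_ball]
  refine integrableOn_ball_of_norm_le_rpow (α := α) (C := 1) ?_ ?_ ?_ ?_
  · simp
  · simpa using hα
  · refine Filter.Eventually.of_forall fun x => ?_
    rw [one_mul, Real.norm_of_nonneg (by positivity)]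
  · exact (measurable_norm.pow_const _).aestronglyMeasurable

lemma le_KK (α R : ℝ) (z ζ : ℂ) (hz : ‖z‖ < R) (hζ : ζ ∈ ball (0 : ℂ) R) :
    ‖z - ζ‖ ^ (-α) = KK α R (z - ζ) := by
  unfold KK
  rw [Set.indicator_of_mem]
  rw [mem_ball_zero_iff] at *
  have := norm_sub_le z ζ
  linarith

lemma riesz_int (α R : ℝ) (hα : α < 2) (z : ℂ) (hz : ‖z‖ < R) :
    IntegrableOn (fun ζ => ‖z - ζ‖ ^ (-α)) (ball 0 R) := by
  have h1 : Integrable (fun ζ => KK α R (z - ζ)) := (KK_int α R hα).comp_sub_left z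
  refine h1.integrableOn.congr_fun (fun ζ hζ => ?_) measurableSet_ball
  exact (le_KK α R z ζ hz hζ).symm

lemma riesz_le (α R : ℝ) (hα : α < 2) (z : ℂ) (hz : ‖z‖ < R) :
    ∫ ζ in ball 0 R, ‖z - ζ‖ ^ (-α) ≤ ∫ w, KK α R w := by
  have h1 : Integrable (fun ζ => KK α R (z - ζ)) := (KK_int α R hα).comp_sub_left z
  rw [← integral_sub_left_eq_self (KK α R) volume z]
  rw [setIntegral_congr_fun measurableSet_ball (fun ζ hζ => le_KK α R z ζ hz hζ)]
  refine setIntegral_le_integral h1 (Filter.Eventually.of_forall fun ζ => ?_)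
  unfold KK
  exact Set.indicator_nonneg (fun _ _ => by positivity) _

lemma cauchy_int (R : ℝ) (z : ℂ) (hz : ‖z‖ < R) :
    IntegrableOn (fun ζ => (z - ζ)⁻¹) (ball 0 R) := by
  refine (riesz_int 1 R (by norm_num) z hz).mono' ?_ ?_
  · exact ((measurable_const.sub measurable_id).inv).aestronglyMeasurable
  · refine Filter.Eventually.of_forall fun ζ => ?_
    rw [norm_inv, Real.rpow_neg_one]

lemma circ_in (z : ℂ) (r : ℝ) (hr : 0 < r) (hz : r < ‖z‖) :
    Real.circleAverage (fun ζ => (z - ζ)⁻¹) 0 r = z⁻¹ := by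
  rw [DiffContOnCl.circleAverage]
  · simp
  · rw [abs_of_pos hr]
    apply DifferentiableOn.diffContOnCl_ball (R := r) (U := closedBall 0 r) _ subset_rfl
    intro w hw
    have : z - w ≠ 0 := by
      rw [sub_ne_zero]; rintro rfl
      rw [mem_closedBall_zero_iff] at hw; linarith
    have hd : DifferentiableAt ℂ (fun ζ : ℂ => z - ζ) w := by fun_prop
    exact (hd.inv this).differentiableWithinAt

lemma circ_out (z : ℂ) (r : ℝ) (hz0 : z ≠ 0) (hz : ‖z‖ < r) :
    Real.circleAverage (fun ζ => (z - ζ)⁻¹) 0 r = 0 := by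
  have hr : 0 < r := lt_of_le_of_lt (norm_nonneg _) hz
  have h1 := DiffContOnCl.circleAverage_smul_div (f := fun _ => (1 : ℂ)) (R := r) (c := 0) (w := z)
    diffContOnCl_const (by rw [abs_of_pos hr]; simpa using hz)
  have hne : ∀ t, circleMap 0 r t - z ≠ 0 := by
    intro t h0
    rw [sub_eq_zero] at h0
    rw [← h0] at hz
    simp [abs_of_pos hr] at hz
  have hci : CircleIntegrable (fun ζ => (z - ζ)⁻¹) 0 r := by
    apply ContinuousOn.circleIntegrable hr.le
    intro w hw
    have : z - w ≠ 0 := by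
      rw [sub_ne_zero]; rintro rfl
      simp at hw; linarith
    apply ContinuousAt.continuousWithinAt
    exact (continuousAt_const.sub continuousAt_id).inv₀ this
  have h2 : Real.circleAverage (fun ζ => ((ζ - 0) / (ζ - z)) • (1 : ℂ)) 0 r =
      Real.circleAverage (fun ζ => 1 + (-z) • (z - ζ)⁻¹) 0 r := by
    unfold Real.circleAverage
    congr 2
    ext t
    have := hne t
    have h3 : z - circleMap 0 r t ≠ 0 := by rw [← neg_ne_zero]; simpa using this
    simp only [smul_eq_mul]
    field_simp
    ring
  have h3 : Real.circleAverage (fun ζ => 1 + (-z) • (z - ζ)⁻¹) 0 r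
      = 1 + (-z) • Real.circleAverage (fun ζ => (z - ζ)⁻¹) 0 r := by
    have := Real.circleAverage_add (f₁ := fun _ : ℂ => (1 : ℂ)) (f₂ := (-z) • fun ζ => (z - ζ)⁻¹)
      (c := 0) (R := r) (circleIntegrable_const _ _ _) (hci.const_smul)
    rw [Real.circleAverage_smul, Real.circleAverage_const] at this
    exact this
  rw [h2, h3] at h1
  have : z * Real.circleAverage (fun ζ => (z - ζ)⁻¹) 0 r = 0 := by
    rw [smul_eq_mul] at h1
    linear_combination -h1
  exact (mul_eq_zero.1 this).resolve_left hz0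

lemma inner_avg (f : ℂ → ℂ) (r : ℝ) :
    ∫ y in Set.Ioo (-Real.pi) Real.pi, f (Complex.polarCoord.symm (r, y))
      = (2 * Real.pi) • Real.circleAverage f 0 r := by
  unfold Real.circleAverage
  rw [smul_smul, mul_inv_cancel₀ (by positivity), one_smul]
  have hper : Function.Periodic (fun t => f (circleMap 0 r t)) (2 * Real.pi) := by
    intro t; simp only; rw [periodic_circleMap]
  have := hper.intervalIntegral_add_eq 0 (-Real.pi)
  rw [zero_add] at this
  rw [this, show -Real.pi + 2 * Real.pi = Real.pi by ring,
    intervalIntegral.integral_of_le (by linarith [Real.pi_pos]), integral_Ioc_eq_integral_Ioo]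
  congr 1
  ext y
  rw [Complex.polarCoord_symm_apply]
  simp only [circleMap, zero_add]
  rw [Complex.exp_mul_I]
  push_cast
  rfl

lemma cauchy_area (R : ℝ) (z : ℂ) (hz0 : z ≠ 0) (hz : ‖z‖ < R) :
    ∫ ζ in ball 0 R, (z - ζ)⁻¹ = Real.pi * star z := by
  set G : ℂ → ℂ := Set.indicator (ball 0 R) (fun ζ => (z - ζ)⁻¹) with hG
  have hGm : Measurable G := by
    apply Measurable.indicator _ measurableSet_ball
    exact (measurable_const.sub measurable_id).inv
  have hGi : Integrable G := by
    rw [hG, integrable_indicator_iff measurableSet_ball]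
    exact cauchy_int R z hz
  have hsm : Measurable (fun p : ℝ × ℝ => Complex.polarCoord.symm p) := by
    simp_rw [Complex.polarCoord_symm_apply]
    apply Continuous.measurable
    fun_prop
  have hprod : IntegrableOn (fun p : ℝ × ℝ => p.1 • G (Complex.polarCoord.symm p))
      (Set.Ioi 0 ×ˢ Set.Ioo (-Real.pi) Real.pi) (volume.prod volume) := by
    refine ⟨(measurable_fst.smul (hGm.comp hsm)).aestronglyMeasurable, ?_⟩
    have h1 := Complex.lintegral_comp_polarCoord_symm (fun w => ‖G w‖ₑ)
    unfold HasFiniteIntegral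
    have h2 := hGi.2
    unfold HasFiniteIntegral at h2
    rw [← h1] at h2
    refine lt_of_eq_of_lt ?_ h2
    refine setLIntegral_congr_fun (measurableSet_Ioi.prod measurableSet_Ioo) ?_
    rintro ⟨r, y⟩ ⟨hr, -⟩
    simp only [Set.mem_Ioi] at hr
    simp only [enorm_smul, smul_eq_mul]
    rw [Real.enorm_of_nonneg hr.le]
  rw [← integral_indicator measurableSet_ball, ← hG, ← Complex.integral_comp_polarCoord_symm]
  have ht : polarCoord.target = Set.Ioi (0 : ℝ) ×ˢ Set.Ioo (-Real.pi) Real.pi := rfl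
  rw [ht, Measure.volume_eq_prod, setIntegral_prod _ hprod]
  have hin : ∀ r ∈ Set.Ioi (0 : ℝ), r ≠ ‖z‖ →
      ∫ y in Set.Ioo (-Real.pi) Real.pi, r • G (Complex.polarCoord.symm (r, y)) =
      Set.indicator (Set.Ioo 0 ‖z‖) (fun r : ℝ => (r : ℂ) * (2 * Real.pi * z⁻¹)) r := by
    intro r hr hne
    rw [Set.mem_Ioi] at hr
    rw [integral_smul, inner_avg]
    have hnorm : ∀ t, ‖circleMap 0 r t‖ = r := fun t => by simp [abs_of_pos hr]
    by_cases hrR : r < R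
    · have : Real.circleAverage G 0 r = Real.circleAverage (fun ζ => (z - ζ)⁻¹) 0 r := by
        unfold Real.circleAverage
        congr 2
        ext t
        rw [hG, Set.indicator_of_mem]
        rw [mem_ball_zero_iff, hnorm]; exact hrR
      rw [this]
      rcases lt_or_gt_of_ne hne with hlt | hgt
      · rw [circ_in z r hr hlt, Set.indicator_of_mem (show r ∈ Set.Ioo 0 ‖z‖ from ⟨hr, hlt⟩)]
        simp [Complex.real_smul]
      · rw [circ_out z r hz0 hgt, Set.indicator_of_notMem (fun hh => absurd hh.2 (not_lt.2 hgt.le))]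
        simp
    · have : Real.circleAverage G 0 r = 0 := by
        unfold Real.circleAverage
        have : (fun t => G (circleMap 0 r t)) = fun _ => 0 := by
          ext t
          rw [hG, Set.indicator_of_notMem]
          rw [mem_ball_zero_iff, hnorm]; exact hrR
        rw [this]; simp
      rw [this, Set.indicator_of_notMem (fun hh => by linarith [hh.2])]
      simp
  have hae : ∀ᵐ r ∂(volume : Measure ℝ), r ∈ Set.Ioi (0 : ℝ) →
      ∫ y in Set.Ioo (-Real.pi) Real.pi, r • G (Complex.polarCoord.symm (r, y)) =
      Set.indicator (Set.Ioo 0 ‖z‖) (fun r : ℝ => (r : ℂ) * (2 * Real.pi * z⁻¹)) r := by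
    have : ∀ᵐ r ∂(volume : Measure ℝ), r ≠ ‖z‖ := Measure.ae_ne volume ‖z‖
    filter_upwards [this] with r hr hr0 using hin r hr0 hr
  rw [setIntegral_congr_ae measurableSet_Ioi hae, setIntegral_indicator measurableSet_Ioo]
  rw [Set.inter_eq_right.2 (fun r hr => hr.1), ← integral_Ioc_eq_integral_Ioo,
    ← intervalIntegral.integral_of_le (norm_nonneg z), intervalIntegral.integral_mul_const,
    intervalIntegral.integral_ofReal, integral_id]
  have hzz : (‖z‖ : ℂ) ^ 2 = z * star z := by
    rw [Complex.star_def, Complex.mul_conj']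
  push_cast
  rw [hzz]
  field_simp
  ring

section fin

variable {X : Type*} [TopologicalSpace X] [CompactSpace X]

lemma finite_sum_approx (𝒜 : Subalgebra ℂ C(X, ℂ)) (g : C(X, ℂ)) (R : ℝ) (hR : ∀ x, ‖g x‖ < R)
    (η δ : ℝ) (F : ℂ → C(X, ℂ)) (hF : ∀ ζ, F ζ ∈ 𝒜)
    (hFb : ∀ ζ x ζ', ‖ζ' - ζ‖ < δ → g x ≠ ζ' →
      ‖F ζ x - (g x - ζ')⁻¹‖ ≤ η * ‖g x - ζ'‖ ^ (-(3 / 2) : ℝ)) (t : Finset ℂ) :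
    ∀ S : Set ℂ, MeasurableSet S → S ⊆ ball 0 R → S ⊆ ⋃ c ∈ t, ball c δ →
      ∃ u ∈ 𝒜, ∀ x, ‖u x - ∫ ζ in S, (g x - ζ)⁻¹‖ ≤ η * ∫ ζ in S, ‖g x - ζ‖ ^ (-(3 / 2) : ℝ) := by
  induction t using Finset.induction_on with
  | empty =>
    intro S _ _ hS
    have : S = ∅ := by simpa using hS
    subst this
    exact ⟨0, 𝒜.zero_mem, fun x => by simp⟩
  | insert c t hc ih =>
    intro S hSm hSR hS
    obtain ⟨u, hu, hub⟩ := ih (S \ ball c δ) (hSm.diff measurableSet_ball)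
      (Set.sdiff_subset.trans hSR) (by
        rintro x ⟨hx, hx'⟩
        have := hS hx
        simp only [Finset.mem_insert, Set.iUnion_iUnion_eq_or_left, Set.mem_union] at this
        exact this.resolve_left hx')
    set T := S ∩ ball c δ with hT
    have hTm : MeasurableSet T := hSm.inter measurableSet_ball
    have hTR : T ⊆ ball 0 R := Set.inter_subset_left.trans hSR
    refine ⟨(volume.real T : ℂ) • F c + u, 𝒜.add_mem (𝒜.smul_mem (hF c) _) hu, fun x => ?_⟩
    have hi1 := cauchy_int R (g x) (hR x)
    have hi2 := riesz_int (3 / 2) R (by norm_num) (g x) (hR x)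
    have hfin : volume T ≠ ⊤ := ((measure_mono hTR).trans_lt measure_ball_lt_top).ne
    have e1 : ∫ ζ in S, (g x - ζ)⁻¹ = (∫ ζ in T, (g x - ζ)⁻¹) + ∫ ζ in S \ ball c δ, (g x - ζ)⁻¹ :=
      (integral_inter_add_sdiff measurableSet_ball (hi1.mono_set hSR)).symm
    have e2 : ∫ ζ in S, ‖g x - ζ‖ ^ (-(3 / 2) : ℝ) = (∫ ζ in T, ‖g x - ζ‖ ^ (-(3 / 2) : ℝ)) +
        ∫ ζ in S \ ball c δ, ‖g x - ζ‖ ^ (-(3 / 2) : ℝ) :=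
      (integral_inter_add_sdiff measurableSet_ball (hi2.mono_set hSR)).symm
    have e3 : ∫ ζ in T, (F c x - (g x - ζ)⁻¹) = volume.real T * F c x - ∫ ζ in T, (g x - ζ)⁻¹ := by
      rw [integral_sub (f := fun _ => F c x) (integrableOn_const (C := F c x) hfin) (hi1.mono_set hTR), setIntegral_const,
        Complex.real_smul]
    have b1 : ‖∫ ζ in T, (F c x - (g x - ζ)⁻¹)‖ ≤ ∫ ζ in T, η * ‖g x - ζ‖ ^ (-(3 / 2) : ℝ) := by
      apply norm_integral_le_of_norm_le
      · exact (hi2.mono_set hTR).const_mul η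
      · rw [ae_restrict_iff' hTm]
        have : ∀ᵐ ζ ∂(volume : Measure ℂ), ζ ≠ g x := Measure.ae_ne volume (g x)
        filter_upwards [this] with ζ hζ hζT
        refine hFb c x ζ ?_ (Ne.symm hζ)
        have := hζT.2
        rwa [mem_ball, dist_eq_norm] at this
    rw [e3, integral_const_mul] at b1
    rw [e1, e2, mul_add]
    have : ((volume.real T : ℂ) • F c + u) x - ((∫ ζ in T, (g x - ζ)⁻¹) +
        ∫ ζ in S \ ball c δ, (g x - ζ)⁻¹) = (volume.real T * F c x - ∫ ζ in T, (g x - ζ)⁻¹) +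
        (u x - ∫ ζ in S \ ball c δ, (g x - ζ)⁻¹) := by
      simp only [ContinuousMap.add_apply, ContinuousMap.smul_apply, smul_eq_mul]
      ring
    rw [this]
    exact (norm_add_le _ _).trans (add_le_add b1 (hub x))

lemma star_mem_alg [ContractibleSpace X] (𝒜 : Subalgebra ℂ C(X, ℂ)) (h : C(X, ℂ))
    (hinj : Function.Injective h) (hcl : IsClosed (𝒜 : Set C(X, ℂ))) (hh : h ∈ 𝒜)
    (hint : interior (Set.range h) = ∅) : star h ∈ 𝒜 := by
  have hconst : ∀ c : ℂ, ContinuousMap.const X c ∈ 𝒜 := fun c => 𝒜.algebraMap_mem c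
  obtain ⟨a, ha⟩ : ∃ a, a ∉ Set.range h := by
    by_contra hcon
    push Not at hcon
    rw [Set.eq_univ_of_forall hcon, interior_univ] at hint
    exact Set.univ_nonempty.ne_empty hint
  set g : C(X, ℂ) := h - ContinuousMap.const X a with hg
  have hgx : ∀ x, g x = h x - a := fun x => rfl
  have hg0 : ∀ x, g x ≠ 0 := fun x => sub_ne_zero.2 (fun h0 => ha ⟨x, h0⟩)
  set R := ‖g‖ + 1 with hRdef
  have hR : ∀ x, ‖g x‖ < R := fun x => lt_of_le_of_lt (g.norm_coe_le_norm x) (by linarith)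
  set M := ∫ w, KK (3 / 2) R w with hM
  have hM0 : 0 ≤ M := integral_nonneg fun w => by
    unfold KK
    exact Set.indicator_nonneg (fun _ _ => by positivity) _
  have hmem : (Real.pi : ℂ) • star g ∈ 𝒜 := by
    have : (Real.pi : ℂ) • star g ∈ closure (𝒜 : Set C(X, ℂ)) := by
      rw [Metric.mem_closure_iff]
      intro ε hε
      obtain ⟨δ, hδ, hδε⟩ : ∃ δ > 0, 10000 * √δ * M ≤ ε / 2 := by
        refine ⟨(ε / (20000 * (M + 1))) ^ 2, by positivity, ?_⟩
        rw [Real.sqrt_sq (by positivity)]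
        have : 10000 * (ε / (20000 * (M + 1))) * M = ε / 2 * (M / (M + 1)) := by
          field_simp; ring
        rw [this]
        have : M / (M + 1) ≤ 1 := by rw [div_le_one (by positivity)]; linarith
        nlinarith
      choose F hF hFb using fun ζ => key_approx 𝒜 h hinj hcl hh hint δ hδ (ζ + a)
      obtain ⟨t, -, ht, htc⟩ := (isCompact_closedBall (0 : ℂ) R).finite_cover_balls hδ
      obtain ⟨u, hu, hub⟩ := finite_sum_approx 𝒜 g R hR (10000 * √δ) δ F hF (by
        intro ζ x ζ' h1 h2
        have := hFb ζ x (ζ' + a) (by rwa [add_sub_add_right_eq_sub]) (by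
          intro h3; apply h2; rw [hgx, h3]; ring)
        rw [show h x - (ζ' + a) = g x - ζ' by rw [hgx]; ring] at this
        exact this) ht.toFinset (ball 0 R) measurableSet_ball subset_rfl (by
          simpa using ball_subset_closedBall.trans htc)
      refine ⟨u, hu, ?_⟩
      refine lt_of_le_of_lt ((ContinuousMap.dist_le (C := ε / 2) (by positivity)).2 ?_)
        (by linarith)
      intro x
      rw [dist_eq_norm, norm_sub_rev]
      have h1 := hub x
      rw [cauchy_area R (g x) (hg0 x) (hR x)] at h1
      refine h1.trans (le_trans ?_ hδε)
      gcongr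
      exact riesz_le (3 / 2) R (by norm_num) (g x) (hR x)
    rwa [hcl.closure_eq] at this
  have h2 := 𝒜.add_mem (𝒜.smul_mem hmem (Real.pi : ℂ)⁻¹) (hconst (star a))
  convert h2 using 1
  ext x
  have : (Real.pi : ℂ) ≠ 0 := by exact_mod_cast Real.pi_ne_zero
  simp [hgx, this]

lemma poly_dense [ContractibleSpace X] (h : C(X, ℂ)) (hinj : Function.Injective h)
    (hint : interior (Set.range h) = ∅) (α : C(X, ℂ)) (η : ℝ) (hη : 0 < η) :
    ∃ q : ℂ[X], ∀ x, ‖q.eval (h x) - α x‖ < η := by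
  set 𝒜 := (Algebra.adjoin ℂ {h}).topologicalClosure with hA
  have hcl : IsClosed (𝒜 : Set C(X, ℂ)) := Subalgebra.isClosed_topologicalClosure _
  have hh : h ∈ 𝒜 := Subalgebra.le_topologicalClosure _ (Algebra.self_mem_adjoin_singleton ℂ h)
  have hs := star_mem_alg 𝒜 h hinj hcl hh hint
  have hle : ∀ f ∈ 𝒜, star f ∈ 𝒜 := by
    intro f hf
    have hc : IsClosed {f : C(X, ℂ) | star f ∈ 𝒜} := hcl.preimage continuous_star
    have hsub : ((Algebra.adjoin ℂ {h} : Subalgebra ℂ C(X, ℂ)) : Set C(X, ℂ)) ⊆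
        {f : C(X, ℂ) | star f ∈ 𝒜} := by
      intro f hf
      change star f ∈ 𝒜
      induction hf using Algebra.adjoin_induction with
      | mem x hx => rw [Set.mem_singleton_iff.1 hx]; exact hs
      | algebraMap r => rw [← algebraMap_star_comm]; exact 𝒜.algebraMap_mem _
      | add x y _ _ h1 h2 => rw [star_add]; exact 𝒜.add_mem h1 h2
      | mul x y _ _ h1 h2 => rw [star_mul]; exact 𝒜.mul_mem h2 h1
    exact closure_minimal hsub hc hf
  let B : StarSubalgebra ℂ C(X, ℂ) := { 𝒜 with star_mem' := fun {f} hf => hle f hf }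
  have htop := ContinuousMap.starSubalgebra_topologicalClosure_eq_top_of_separatesPoints B (by
    intro x y hxy
    exact ⟨h, ⟨h, hh, rfl⟩, hinj.ne hxy⟩)
  have hα : α ∈ 𝒜 := by
    have h1 : α ∈ B.topologicalClosure := by rw [htop]; trivial
    have h2 : α ∈ closure (𝒜 : Set C(X, ℂ)) := h1
    rwa [hcl.closure_eq] at h2
  have h3 : α ∈ closure ((Algebra.adjoin ℂ {h} : Subalgebra ℂ C(X, ℂ)) : Set C(X, ℂ)) := hα
  rw [Metric.mem_closure_iff] at h3
  obtain ⟨f, hf, hd⟩ := h3 η hη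
  rw [Algebra.adjoin_singleton_eq_range_aeval] at hf
  obtain ⟨q, rfl⟩ := hf
  refine ⟨q, fun x => ?_⟩
  refine lt_of_le_of_lt ?_ hd
  rw [dist_comm]
  refine le_of_eq_of_le ?_ (ContinuousMap.dist_apply_le_dist x)
  rw [dist_eq_norm]
  congr 2
  change _ = (aeval h q) x
  have := Polynomial.aeval_algHom_apply (ContinuousMap.evalAlgHom ℂ ℂ x) h q
  simpa using this

end fin

end EnsReach

/-- sufficient condition for uniform ensemble reachability of a
single-input pair satisfying the necessary conditions (pointwise Kalman rank, pairwise
disjoint spectra, `P` compact contractible with empty interior): if the characteristic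
polynomial of `A(θ)` is `z^n + c_{n−1}z^{n−1} + ⋯ + c_1 z + a_0(θ)` with
parameter-independent coefficients `c_1, …, c_{n−1}` and a continuous constant term
`a_0`, then `(A, b)` is uniformly ensemble reachable. -/
theorem stmt_10 {n : ℕ} (P : Set ℂ) (hP : IsCompact P) (hPne : P.Nonempty)
    [ContractibleSpace P] (hint : interior P = ∅)
    (A : P → Matrix (Fin n) (Fin n) ℂ) (b : P → Fin n → ℂ)
    (hA : Continuous A) (hb : Continuous b)
    (hrank : ∀ θ : P, (Matrix.of fun i k : Fin n => ((A θ ^ (k : ℕ)).mulVec (b θ)) i).rank = n)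
    (hspec : ∀ θ θ' : P, θ ≠ θ' → Disjoint (spectrum ℂ (A θ)) (spectrum ℂ (A θ')))
    (c : ℕ → ℂ) (a0 : P → ℂ) (ha0 : Continuous a0)
    (hchar : ∀ θ : P, (A θ).charpoly =
      X ^ n + (∑ i ∈ Finset.Ico 1 n, C (c i) * X ^ i) + C (a0 θ)) :
    UniformEnsembleReachable1 P A b := by
  haveI : CompactSpace P := isCompact_iff_compactSpace.1 hP
  intro f hf ε hε
  rcases Nat.eq_zero_or_pos n with hn | hn
  · subst hn
    refine ⟨0, fun θ => ?_⟩
    rw [Subsingleton.elim (((Polynomial.aeval (A θ)) 0).mulVec (b θ) - f θ) 0, norm_zero]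
    exact hε
  haveI : NeZero n := ⟨hn.ne'⟩
  let h : C(P, ℂ) := ⟨fun θ => -a0 θ, ha0.neg⟩
  have hinj : Function.Injective h := by
    intro θ θ' hθ
    by_contra hne
    have h1 : a0 θ = a0 θ' := neg_injective hθ
    have h2 : (A θ).charpoly = (A θ').charpoly := by rw [hchar, hchar, h1]
    obtain ⟨μ, hμ⟩ := spectrum.nonempty_of_isAlgClosed_of_finiteDimensional ℂ (A θ)
    have hμ' : μ ∈ spectrum ℂ (A θ') := by
      rw [Matrix.mem_spectrum_iff_isRoot_charpoly] at hμ ⊢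
      rwa [← h2]
    exact Set.disjoint_left.1 (hspec θ θ' hne) hμ hμ'
  have hri := EnsReach.interior_range_empty P hP hint h hinj
  set g : ℂ[X] := X ^ n + (∑ i ∈ Finset.Ico 1 n, C (c i) * X ^ i) with hg
  have hgA : ∀ θ, aeval (A θ) g = algebraMap ℂ _ (h θ) := by
    intro θ
    have h1 := Matrix.aeval_self_charpoly (A θ)
    rw [hchar, map_add, aeval_C] at h1
    rw [eq_neg_of_add_eq_zero_left h1]
    change _ = algebraMap ℂ _ (-a0 θ)
    rw [map_neg]
  let K : P → Matrix (Fin n) (Fin n) ℂ :=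
    fun θ => Matrix.of fun i k : Fin n => ((A θ ^ (k : ℕ)).mulVec (b θ)) i
  have hkc : ∀ k : ℕ, Continuous fun θ => (A θ ^ k).mulVec (b θ) :=
    fun k => (hA.pow k).matrix_mulVec hb
  have hKc : Continuous K := by
    apply continuous_matrix
    intro i k
    exact (continuous_apply i).comp (hkc k)
  have hdet : ∀ θ, (K θ).det ≠ 0 := by
    intro θ h0
    obtain ⟨v, hv, hv0⟩ := Matrix.exists_mulVec_eq_zero_iff.2 h0
    have hr : (K θ).rank = n := hrank θ
    unfold Matrix.rank at hr
    have h1 := LinearMap.finrank_range_add_finrank_ker (K θ).mulVecLin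
    rw [hr, Module.finrank_fin_fun, Nat.add_eq_left, Submodule.finrank_eq_zero] at h1
    apply hv
    have : v ∈ LinearMap.ker (K θ).mulVecLin := by simpa using hv0
    rw [h1] at this
    simpa using this
  let α : P → Fin n → ℂ := fun θ => ((K θ).det)⁻¹ • (K θ).adjugate.mulVec (f θ)
  have hαc : Continuous α :=
    (hKc.matrix_det.inv₀ hdet).smul (hKc.matrix_adjugate.matrix_mulVec hf)
  have hαf : ∀ θ, (K θ).mulVec (α θ) = f θ := by
    intro θ
    simp only [α]
    rw [Matrix.mulVec_smul, Matrix.mulVec_mulVec, Matrix.mul_adjugate, Matrix.smul_mulVec,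
      Matrix.one_mulVec, smul_smul, inv_mul_cancel₀ (hdet θ), one_smul]
  have hfs : ∀ θ, f θ = ∑ k : Fin n, α θ k • (A θ ^ (k : ℕ)).mulVec (b θ) := by
    intro θ
    rw [← hαf θ]
    ext i
    simp only [Matrix.mulVec, dotProduct, Finset.sum_apply, Pi.smul_apply, smul_eq_mul, K,
      Matrix.of_apply]
    exact Finset.sum_congr rfl fun k _ => mul_comm _ _
  let v : Fin n → C(P, Fin n → ℂ) := fun k => ⟨_, hkc k⟩
  set S := ∑ k, ‖v k‖ with hS
  have hS0 : 0 ≤ S := Finset.sum_nonneg fun k _ => norm_nonneg _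
  choose q hq using fun k : Fin n => EnsReach.poly_dense h hinj hri
    ⟨fun θ => α θ k, (continuous_apply k).comp hαc⟩ (ε / (S + 1)) (by positivity)
  refine ⟨∑ k, (q k).comp g * X ^ (k : ℕ), fun θ => ?_⟩
  have hp : (aeval (A θ) (∑ k : Fin n, (q k).comp g * X ^ (k : ℕ))).mulVec (b θ) =
      ∑ k : Fin n, (q k).eval (h θ) • (A θ ^ (k : ℕ)).mulVec (b θ) := by
    rw [map_sum, Matrix.sum_mulVec]
    refine Finset.sum_congr rfl fun k _ => ?_
    rw [map_mul, map_pow, aeval_X, aeval_comp, hgA, aeval_algebraMap_apply, coe_aeval_eq_eval,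
      Algebra.algebraMap_eq_smul_one, smul_mul_assoc, one_mul, Matrix.smul_mulVec]
  rw [hp, hfs θ, ← Finset.sum_sub_distrib]
  calc _ ≤ ∑ k : Fin n, ε / (S + 1) * ‖v k‖ := by
        refine norm_sum_le_of_le _ fun k _ => ?_
        rw [← sub_smul, norm_smul]
        exact mul_le_mul (hq k θ).le ((v k).norm_coe_le_norm θ) (norm_nonneg _) (by positivity)
    _ = ε * (S / (S + 1)) := by rw [← Finset.mul_sum, ← hS]; ring
    _ < ε * 1 := by
        apply mul_lt_mul_of_pos_left _ hε
        rw [div_lt_one (by positivity)]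
        linarith
    _ = ε := mul_one ε
end

section
/- Let P ⊆ ℂ be compact and homeomorphic to the interval [0,1], and let A : P → ℂ^{n×n} and b : P → ℂ^n be continuous. Suppose that: (a) for every θ ∈ P the Kalman matrix (b(θ), A(θ)b(θ), …, A(θ)^{n−1}b(θ)) has rank n; (b) σ(A(θ)) ∩ σ(A(θ′)) = ∅ for all θ, θ′ ∈ P with θ ≠ θ′; and (c) for every θ ∈ P the matrix A(θ) has n distinct eigenvalues. Then (A, b) is uniformly ensemble reachable on C(P, ℂ^n). -/
open Polynomial Matrix

theorem aux_no_circle_log (a : ℂ) (R : ℝ) (hR : 0 < R) (H : ℂ → ℂ) (hH : Continuous H)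
    (h : ∀ z, ‖z - a‖ = R → Complex.exp (H z) = z - a) : False := by
  have key : ∀ t : ℝ, H (a + R * Complex.exp (t * Complex.I)) - t * Complex.I =
      H (a + R * Complex.exp ((0:ℝ) * Complex.I)) - (0:ℝ) * Complex.I := by
    set φ : ℝ → ℂ := fun t => H (a + R * Complex.exp (t * Complex.I)) - t * Complex.I with hφ
    have hφc : Continuous φ := by fun_prop
    have hexp : ∀ t, Complex.exp (φ t) = R := by
      intro t
      simp only [hφ]
      rw [Complex.exp_sub, h]
      · field_simp
        ring
      · simp [Complex.norm_exp, abs_of_pos hR]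
    intro t
    have : Std.Symm (fun s t => φ s = φ t) := ⟨fun _ _ => Eq.symm⟩
    refine PreconnectedSpace.induction₂ (fun s t => φ s = φ t) (fun s => ?_)
      ⟨fun _ _ _ => Eq.trans⟩ t 0
    have : ∀ᶠ y in nhds s, ‖φ y - φ s‖ < 1 := by
      have := Metric.continuous_iff'.1 hφc s 1 one_pos
      simpa [dist_eq_norm] using this
    filter_upwards [this] with y hy
    have h1 : Complex.exp (φ s) = Complex.exp (φ y) := by rw [hexp, hexp]
    obtain ⟨n, hn⟩ := Complex.exp_eq_exp_iff_exists_int.1 h1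
    have h2 : ‖φ y - φ s‖ = |(n:ℝ)| * (2 * Real.pi) := by
      rw [hn]; simp [abs_of_pos Real.pi_pos]
    rw [h2] at hy
    have hn0 : n = 0 := by
      by_contra hne
      have : (1:ℝ) ≤ |(n:ℝ)| := by exact_mod_cast Int.one_le_abs hne
      nlinarith [Real.pi_gt_three]
    rw [hn, hn0]; simp
  have := key (2 * Real.pi)
  simp only [Complex.ofReal_zero, zero_mul, Complex.exp_zero, Complex.ofReal_mul, Complex.ofReal_ofNat, Complex.exp_two_pi_mul_I, sub_zero] at this
  simp at this

theorem aux_component_unbounded {X : Type*} [TopologicalSpace X] [CompactSpace X] [T2Space X]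
    (e : X → ℂ) (he : Continuous e) (hinj : Function.Injective e)
    (hlog : ∀ F : X → ℂ, Continuous F → (∀ x, F x ≠ 0) → ∃ G : X → ℂ, Continuous G ∧
      ∀ x, Complex.exp (G x) = F x) (a : ℂ) (ha : a ∉ Set.range e) :
    ¬ Bornology.IsBounded (connectedComponentIn (Set.range e)ᶜ a) := by
  classical
  intro hb
  set K := Set.range e with hK
  have hKc : IsClosed K := (isCompact_range he).isClosed
  set U := connectedComponentIn Kᶜ a with hU
  have hUo : IsOpen U := hKc.isOpen_compl.connectedComponentIn
  have haU : a ∈ U := mem_connectedComponentIn ha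
  obtain ⟨g, hgc, hg⟩ := hlog (fun x => e x - a) (by fun_prop)
    (fun x hx => ha ⟨x, by linear_combination hx⟩)
  have hemb : Topology.IsClosedEmbedding e := he.isClosedEmbedding hinj
  obtain ⟨G, hG⟩ := ContinuousMap.exists_extension hemb (⟨g, hgc⟩ : C(X, ℂ))
  have hG' : ∀ x, G (e x) = g x := fun x => congrArg (fun f : C(X, ℂ) => f x) hG
  have hfr : frontier U ⊆ K := by
    intro z hz
    by_contra hzK
    have hzV : z ∈ connectedComponentIn Kᶜ z := mem_connectedComponentIn hzK
    have hVo : IsOpen (connectedComponentIn Kᶜ z) := hKc.isOpen_compl.connectedComponentIn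
    obtain ⟨w, hw1, hw2⟩ := mem_closure_iff.1 hz.1 _ hVo hzV
    have h1 := connectedComponentIn_eq hw1
    have h2 := connectedComponentIn_eq hw2
    have : z ∈ U := by rw [hU, h2, ← h1]; exact hzV
    exact hz.2 (by rwa [hUo.interior_eq])
  set F : ℂ → ℂ := fun z => if z ∈ U then Complex.exp (G z) else z - a with hF
  have hFc : Continuous F := by
    refine continuous_if (p := fun z => z ∈ U) ?_ (by fun_prop) (by fun_prop)
    intro z hz
    obtain ⟨x, rfl⟩ := hfr hz
    rw [hG', hg]
  have hF0 : ∀ z, F z ≠ 0 := by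
    intro z
    simp only [hF]
    split_ifs with hz
    · exact Complex.exp_ne_zero _
    · intro h
      exact hz (by rwa [sub_eq_zero.1 h])
  obtain ⟨H, hHc, hH⟩ := Complex.exists_continuousOn_eqOn_exp_comp (X := ℂ) (U := Set.univ)
    (by
      have : ContractibleSpace (Set.univ : Set ℂ) :=
        (convex_univ (𝕜 := ℝ)).contractibleSpace ⟨0, trivial⟩
      exact SimplyConnectedSpace.ofContractible _) isOpen_univ (g := F) hFc.continuousOn
    (by rintro ⟨z, -, hz⟩; exact hF0 z hz)
  rw [continuousOn_univ] at hHc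
  obtain ⟨R, hR⟩ := hb.subset_ball a
  have hRpos : 0 < R := by simpa using Metric.nonempty_ball.1 ⟨a, hR haU⟩
  refine aux_no_circle_log a R hRpos H hHc fun z hz => ?_
  have := hH (Set.mem_univ z)
  simp only [Function.comp] at this
  rw [this]
  have hzU : z ∉ U := fun h => by
    have := hR h
    rw [Metric.mem_ball, dist_eq_norm] at this
    linarith
  simp [hF, hzU]

theorem aux_compl_preconnected {X : Type*} [TopologicalSpace X] [CompactSpace X] [T2Space X]
    (e : X → ℂ) (he : Continuous e) (hinj : Function.Injective e)
    (hlog : ∀ F : X → ℂ, Continuous F → (∀ x, F x ≠ 0) → ∃ G : X → ℂ, Continuous G ∧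
      ∀ x, Complex.exp (G x) = F x) : IsPreconnected (Set.range e)ᶜ := by
  obtain ⟨R, hRpos, hR⟩ := (isCompact_range he).isBounded.subset_closedBall_lt 0 0
  set K := Set.range e with hK
  have hout : IsPreconnected (Metric.closedBall (0:ℂ) R)ᶜ := by
    have himg : (Metric.closedBall (0:ℂ) R)ᶜ = Complex.exp '' {w | Real.log R < w.re} := by
      ext z
      simp only [Set.mem_compl_iff, Metric.mem_closedBall, dist_zero_right, not_le, Set.mem_image,
        Set.mem_ofPred_eq]
      constructor
      · intro hz
        have hz0 : z ≠ 0 := by rintro rfl; simp at hz; linarith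
        exact ⟨Complex.log z, by rw [Complex.log_re]; exact Real.log_lt_log hRpos hz,
          Complex.exp_log hz0⟩
      · rintro ⟨w, hw, rfl⟩
        rw [Complex.norm_exp]
        exact (Real.log_lt_iff_lt_exp hRpos).1 hw
    rw [himg]
    exact (convex_halfSpace_re_gt _).isPreconnected.image _ Complex.continuous_exp.continuousOn
  have hsub : (Metric.closedBall (0:ℂ) R)ᶜ ⊆ Kᶜ := Set.compl_subset_compl.2 hR
  have hmeet : ∀ a ∉ K, ∃ z ∈ connectedComponentIn Kᶜ a, z ∈ (Metric.closedBall (0:ℂ) R)ᶜ := by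
    intro a ha
    by_contra! hcon
    refine aux_component_unbounded e he hinj hlog a ha ((Metric.isBounded_closedBall (x := (0:ℂ)) (r := R)).subset fun z hz => ?_)
    simpa using hcon z hz
  have hz0 : ((R + 1 : ℝ) : ℂ) ∈ (Metric.closedBall (0:ℂ) R)ᶜ := by
    simp only [Set.mem_compl_iff, Metric.mem_closedBall, dist_zero_right, Complex.norm_real,
      Real.norm_eq_abs, not_le]
    exact lt_of_lt_of_le (by linarith) (le_abs_self _)
  refine isPreconnected_of_forall ((R + 1 : ℝ) : ℂ) fun a ha => ?_
  obtain ⟨z, hz1, hz2⟩ := hmeet a ha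
  refine ⟨(Metric.closedBall (0:ℂ) R)ᶜ ∪ connectedComponentIn Kᶜ a,
    Set.union_subset hsub (connectedComponentIn_subset _ _), Or.inl hz0,
    Or.inr (mem_connectedComponentIn ha), ?_⟩
  exact IsPreconnected.union z hz2 hz1 hout isPreconnected_connectedComponentIn


theorem aux_arc_log {n : ℕ} (F : Fin n × unitInterval → ℂ) (hF : Continuous F)
    (h0 : ∀ x, F x ≠ 0) : ∃ G : Fin n × unitInterval → ℂ, Continuous G ∧
      ∀ x, Complex.exp (G x) = F x := by
  have : ∀ i : Fin n, ∃ g : unitInterval → ℂ, Continuous g ∧ ∀ t, Complex.exp (g t) = F (i, t) := by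
    intro i
    obtain ⟨H, hHc, hH⟩ := Complex.exists_continuousOn_eqOn_exp_comp (X := ℝ)
      (U := Set.univ)
      (by
        have : ContractibleSpace (Set.univ : Set ℝ) :=
          (convex_univ (𝕜 := ℝ)).contractibleSpace ⟨0, trivial⟩
        exact SimplyConnectedSpace.ofContractible _) isOpen_univ
      (g := fun t => F (i, Set.projIcc 0 1 zero_le_one t))
      (by
        have : Continuous (Set.projIcc (0:ℝ) 1 zero_le_one) := continuous_projIcc
        fun_prop) (by rintro ⟨z, -, hz⟩; exact h0 _ hz)
    refine ⟨fun t => H t, (continuousOn_univ.1 hHc).comp continuous_subtype_val, fun t => ?_⟩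
    have := hH (Set.mem_univ (t : ℝ))
    simpa using this
  choose g hgc hg using this
  refine ⟨fun x => g x.1 x.2, ?_, fun x => hg x.1 x.2⟩
  rw [continuous_prod_of_discrete_left]
  exact hgc

theorem aux_one_arc (g : unitInterval → ℂ) (hg : Continuous g) (hinj : Function.Injective g) :
    interior (Set.range g) = ∅ := by
  by_contra hne
  obtain ⟨p, hp⟩ := Set.nonempty_iff_ne_empty.2 hne
  obtain ⟨r, hr, hball⟩ := Metric.mem_nhds_iff.1 (mem_interior_iff_mem_nhds.1 hp)
  have hemb : Topology.IsClosedEmbedding g := hg.isClosedEmbedding hinj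
  have main : ∀ s u v : unitInterval, s < u → u < v → g s ∈ Metric.ball p r →
      g u ∈ Metric.ball p r → g v ∈ Metric.ball p r → False := by
    intro s u v hsu huv hs hu hv
    have hcon : IsPreconnected (Metric.ball p r \ {g u}) := by
      have hsrc := OpenPartialHomeomorph.univBall_source p r
      have htgt := OpenPartialHomeomorph.univBall_target p hr
      set φ := OpenPartialHomeomorph.univBall p r with hφ
      have himg : Metric.ball p r \ {g u} = φ '' {φ.symm (g u)}ᶜ := by
        ext z
        constructor
        · rintro ⟨hz, hzu⟩
          rw [← htgt] at hz hu
          refine ⟨φ.symm z, fun h => hzu ?_, φ.right_inv hz⟩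
          have h' : φ.symm z = φ.symm (g u) := h
          rw [Set.mem_singleton_iff, ← φ.right_inv hz, h', φ.right_inv hu]
        · rintro ⟨w, hw, rfl⟩
          refine ⟨htgt ▸ φ.map_source (hsrc ▸ Set.mem_univ w), fun h => hw ?_⟩
          have h' : φ w = g u := h
          rw [Set.mem_singleton_iff, ← h', φ.left_inv (hsrc ▸ Set.mem_univ w)]
      rw [himg]
      refine (isConnected_compl_singleton_of_one_lt_rank ?_ _).isPreconnected.image _
        (φ.continuousOn.mono (by rw [hsrc]; exact Set.subset_univ _))
      rw [Complex.rank_real_complex]; norm_num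
    have hcl1 : IsClosed (g '' Set.Iic u) := hemb.isClosedMap _ isClosed_Iic
    have hcl2 : IsClosed (g '' Set.Ici u) := hemb.isClosedMap _ isClosed_Ici
    have := isPreconnected_closed_iff.1 hcon _ _ hcl1 hcl2 ?_ ⟨g s, ⟨hs, fun h => hsu.ne (hinj h)⟩, ⟨s, hsu.le, rfl⟩⟩
      ⟨g v, ⟨hv, fun h => huv.ne' (hinj h)⟩, ⟨v, huv.le, rfl⟩⟩
    · obtain ⟨z, hz, ⟨a, ha, rfl⟩, ⟨b, hb, hab⟩⟩ := this
      have hba := hinj hab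
      exact hz.2 (congrArg g (le_antisymm (show a ≤ u from ha) (hba ▸ hb)))
    · rintro z ⟨hz, -⟩
      obtain ⟨t, rfl⟩ := hball hz
      rcases le_total t u with h | h
      · exact Or.inl ⟨t, h, rfl⟩
      · exact Or.inr ⟨t, h, rfl⟩
  -- three distinct points
  have hpts : ∀ c : ℝ, 0 ≤ c → c < 1 → ∃ t : unitInterval, g t = p + (c * r : ℝ) := by
    intro c hc hc1
    have : p + (c * r : ℝ) ∈ Metric.ball p r := by
      rw [Metric.mem_ball, dist_eq_norm, add_sub_cancel_left, Complex.norm_real, Real.norm_eq_abs,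
        abs_of_nonneg (by positivity)]
      nlinarith
    obtain ⟨t, ht⟩ := hball this
    exact ⟨t, ht⟩
  have hmem : ∀ c : ℝ, 0 ≤ c → c < 1 → p + (c * r : ℝ) ∈ Metric.ball p r := by
    intro c hc hc1
    rw [Metric.mem_ball, dist_eq_norm, add_sub_cancel_left, Complex.norm_real, Real.norm_eq_abs,
        abs_of_nonneg (by positivity)]
    nlinarith
  obtain ⟨t1, h1⟩ := hpts 0 (by norm_num) (by norm_num)
  obtain ⟨t2, h2⟩ := hpts (1/2) (by norm_num) (by norm_num)
  obtain ⟨t3, h3⟩ := hpts (1/4) (by norm_num) (by norm_num)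
  have m1 := h1 ▸ hmem 0 (by norm_num) (by norm_num)
  have m2 := h2 ▸ hmem (1/2) (by norm_num) (by norm_num)
  have m3 := h3 ▸ hmem (1/4) (by norm_num) (by norm_num)
  have n12 : t1 ≠ t2 := by
    rintro rfl
    rw [h1] at h2
    have := Complex.ofReal_injective (add_left_cancel h2)
    linarith
  have n13 : t1 ≠ t3 := by
    rintro rfl
    rw [h1] at h3
    have := Complex.ofReal_injective (add_left_cancel h3)
    linarith
  have n23 : t2 ≠ t3 := by
    rintro rfl
    rw [h2] at h3
    have := Complex.ofReal_injective (add_left_cancel h3)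
    linarith
  rcases lt_or_gt_of_ne n12 with a | a <;> rcases lt_or_gt_of_ne n13 with b | b <;>
    rcases lt_or_gt_of_ne n23 with c | c
  · exact main _ _ _ a c m1 m2 m3
  · exact main _ _ _ b c m1 m3 m2
  · exact absurd (a.trans c) (not_lt.2 b.le)
  · exact main _ _ _ b a m3 m1 m2
  · exact main _ _ _ a b m2 m1 m3
  · exact absurd (b.trans c) (not_lt.2 a.le)
  · exact main _ _ _ c b m2 m3 m1
  · exact main _ _ _ c a m3 m2 m1

theorem aux_arcs_interior {n : ℕ} (e : Fin n × unitInterval → ℂ) (he : Continuous e)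
    (hinj : Function.Injective e) : interior (Set.range e) = ∅ := by
  have hU : Set.range e = ⋃ i : Fin n, Set.range (fun t => e (i, t)) := by
    ext z; simp
  rw [hU]
  have h1 : ∀ i, interior (Set.range (fun t => e (i, t))) = ∅ := fun i =>
    aux_one_arc _ (by fun_prop) (fun a b h => by simpa using hinj h)
  have h2 : ∀ i, IsClosed (Set.range (fun t => e (i, t))) := fun i =>
    (isCompact_range (by fun_prop)).isClosed
  rw [interior_eq_empty_iff_dense_compl, Set.compl_iUnion]
  exact dense_iInter_of_isOpen (fun i => (h2 i).isOpen_compl)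
    (fun i => interior_eq_empty_iff_dense_compl.1 (h1 i))


theorem aux_inv_mem {X : Type*} [TopologicalSpace X] [CompactSpace X]
    (e : C(X, ℂ)) (B : Subalgebra ℂ C(X, ℂ)) (hB : IsClosed (B : Set C(X, ℂ))) (heB : e ∈ B)
    (hcon : IsPreconnected (Set.range e)ᶜ) (a : ℂ) (ha : a ∉ Set.range e) :
    ∃ u ∈ B, ∀ x, u x * (e x - a) = 1 := by
  have hs := Subalgebra.spectrum_eq_of_isPreconnected_compl (𝕜 := ℂ) B ⟨e, heB⟩
    (by simpa [ContinuousMap.spectrum_eq_range] using hcon)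
  have ha' : a ∉ spectrum ℂ (⟨e, heB⟩ : B) := by
    rw [hs]; simpa [ContinuousMap.spectrum_eq_range] using ha
  rw [spectrum.notMem_iff] at ha'
  obtain ⟨v, hv⟩ := ha'.exists_left_inv
  refine ⟨-v.1, B.neg_mem v.2, fun x => ?_⟩
  have := congrArg (fun w : B => (w : C(X, ℂ)) x) hv
  simp at this
  simp
  linear_combination this

theorem aux_sqrt_abs {R : Type*} [NormedCommRing R] [NormedAlgebra ℂ R] [CompleteSpace R] :
    ∃ ρ > 0, ∀ u : R, ‖u‖ < ρ → ∃ s : R, s * s = 1 - u ∧ ‖s - 1‖ < 1 := by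
  have h1 : HasStrictFDerivAt (fun s : R => s * s)
      ((ContinuousLinearEquiv.smulLeft (Units.mk0 (2 : ℂ) two_ne_zero) : R ≃L[ℂ] R) : R →L[ℂ] R)
      1 := by
    have := (hasStrictFDerivAt_id (𝕜 := ℂ) (1 : R)).mul (hasStrictFDerivAt_id (𝕜 := ℂ) (1 : R))
    refine this.congr_fderiv ?_
    ext v
    simp [two_smul]
  have h2 := h1.map_nhds_eq_of_equiv
  have h3 : ∀ᶠ v : R in nhds 1, ‖v - 1‖ < 1 := by
    have hc : ContinuousAt (fun v : R => ‖v - 1‖) 1 := Continuous.continuousAt (by fun_prop)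
    exact hc.eventually_lt (continuousAt_const (y := (1:ℝ))) (by simp)
  have h4 : ∀ᶠ y : R in nhds 1, ∃ v : R, v * v = y ∧ ‖v - 1‖ < 1 := by
    rw [mul_one] at h2
    rw [← h2, Filter.eventually_map]
    filter_upwards [h3] with v hv
    exact ⟨v, rfl, hv⟩
  obtain ⟨ρ, hρ, hball⟩ := Metric.eventually_nhds_iff.1 h4
  exact ⟨ρ, hρ, fun u hun => @hball (1 - u) (by simpa [dist_eq_norm] using hun)⟩

theorem aux_sqrt {X : Type*} [TopologicalSpace X] [CompactSpace X]
    (B : Subalgebra ℂ C(X, ℂ)) (hB : IsClosed (B : Set C(X, ℂ))) :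
    ∃ ρ > 0, ∀ u ∈ B, ‖u‖ < ρ → ∃ s ∈ B, s * s = 1 - u ∧ ‖s - 1‖ < 1 := by
  have : CompleteSpace B := hB.completeSpace_coe
  obtain ⟨ρ, hρ, h⟩ := aux_sqrt_abs (R := B)
  refine ⟨ρ, hρ, fun u hu hun => ?_⟩
  obtain ⟨s, hs, hs'⟩ := h ⟨u, hu⟩ hun
  exact ⟨s, s.2, congrArg Subtype.val hs, hs'⟩

theorem aux_component_far (K : Set ℂ) (hK : IsCompact K) (hcon : IsPreconnected Kᶜ) (a : ℂ)
    (ha : a ∉ K) (δ : ℝ) (hδ : 0 < δ) :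
    ∃ b ∈ connectedComponentIn (Kᶜ ∩ Metric.ball a δ) a, δ / 2 ≤ ‖b - a‖ := by
  by_contra! hcontra
  set V := connectedComponentIn (Kᶜ ∩ Metric.ball a δ) a with hV
  have hOpen : IsOpen (Kᶜ ∩ Metric.ball a δ) := hK.isClosed.isOpen_compl.inter Metric.isOpen_ball
  have hVo : IsOpen V := hOpen.connectedComponentIn
  have haV : a ∈ V := mem_connectedComponentIn ⟨ha, Metric.mem_ball_self hδ⟩
  have hVb : V ⊆ Metric.closedBall a (δ / 2) := fun b hb => by
    rw [Metric.mem_closedBall, dist_eq_norm]; exact (hcontra b hb).le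
  have hsub : Kᶜ ⊆ V := by
    refine hcon.subset_of_closure_inter_subset hVo ⟨a, ha, haV⟩ ?_
    rintro z ⟨hz, hzK⟩
    have hz1 : z ∈ Metric.closedBall a (δ/2) := closure_minimal hVb Metric.isClosed_closedBall hz
    have hz2 : z ∈ Kᶜ ∩ Metric.ball a δ :=
      ⟨hzK, Metric.closedBall_subset_ball (by linarith) hz1⟩
    obtain ⟨w, hw1, hw2⟩ := mem_closure_iff.1 hz _ (hOpen.connectedComponentIn (x := z))
      (mem_connectedComponentIn hz2)
    have h1 := connectedComponentIn_eq hw1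
    have h2 := connectedComponentIn_eq hw2
    rw [hV, h2, ← h1]
    exact mem_connectedComponentIn hz2
  refine NormedSpace.unbounded_univ ℂ ℂ ((hK.isBounded.union
    (Metric.isBounded_closedBall.subset (hsub.trans hVb))).subset fun z _ => ?_)
  by_cases h : z ∈ K
  · exact Or.inl h
  · exact Or.inr h

theorem aux_re_mul_pos (s t : ℂ) (hs : 0 < s.re) (ht : 0 < t.re) (hs2 : 0 < (s ^ 2).re)
    (ht2 : 0 < (t ^ 2).re) : 0 < (s * t).re := by
  simp only [pow_two, Complex.mul_re] at *
  have h1 : |s.im| < s.re := abs_lt_of_sq_lt_sq (by nlinarith) hs.le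
  have h2 : |t.im| < t.re := abs_lt_of_sq_lt_sq (by nlinarith) ht.le
  have : |s.im| * |t.im| < s.re * t.re := mul_lt_mul'' h1 h2 (abs_nonneg _) (abs_nonneg _)
  rw [← abs_mul] at this
  linarith [le_abs_self (s.im * t.im)]

theorem aux_ratio_re_pos (w z : ℂ) (hz : z ≠ 0) (h : ‖w - z‖ < ‖z‖) : 0 < (w / z).re := by
  have h1 : ‖w / z - 1‖ < 1 := by
    rw [div_sub_one hz, norm_div, div_lt_one (norm_pos_iff.2 hz)]
    exact h
  have h2 := (abs_lt.1 ((Complex.abs_re_le_norm (w / z - 1)).trans_lt h1)).1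
  simp at h2
  exact h2

theorem aux_branch {X : Type*} [TopologicalSpace X] [CompactSpace X]
    (e : C(X, ℂ)) (B : Subalgebra ℂ C(X, ℂ)) (hB : IsClosed (B : Set C(X, ℂ))) (heB : e ∈ B)
    (hcon : IsPreconnected (Set.range e)ᶜ) (a : ℂ) (δ : ℝ) (hδ : 0 < δ) (V : Set ℂ)
    (hVc : IsPreconnected V) (hV : V ⊆ (Set.range e)ᶜ ∩ Metric.ball a δ) (b b' : ℂ) (hb : b ∈ V)
    (hb' : b' ∈ V) :
    ∃ s ∈ B, (∀ x, s x ^ 2 * (e x - b) = e x - b') ∧ ∀ x, 4 * δ ≤ ‖e x - a‖ → 0 < (s x).re := by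
  have hne : ∀ c ∈ V, ∀ x, e x - c ≠ 0 := fun c hc x h =>
    (hV hc).1 ⟨x, by linear_combination h⟩
  -- positivity of the squares
  have hsq : ∀ c ∈ V, ∀ d ∈ V, ∀ (s : C(X, ℂ)), (∀ x, s x ^ 2 * (e x - c) = e x - d) →
      ∀ x, 4 * δ ≤ ‖e x - a‖ → 0 < (s x ^ 2).re := by
    intro c hc d hd s hs x hx
    have h1 : s x ^ 2 = (e x - d) / (e x - c) := by
      rw [eq_div_iff (hne c hc x), hs]
    rw [h1]
    apply aux_ratio_re_pos _ _ (hne c hc x)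
    have hc' := (hV hc).2
    have hd' := (hV hd).2
    rw [Metric.mem_ball, dist_eq_norm] at hc' hd'
    have e1 : ‖e x - d - (e x - c)‖ ≤ ‖c - a‖ + ‖d - a‖ := by
      rw [show e x - d - (e x - c) = (c - a) - (d - a) by ring]; exact norm_sub_le _ _
    have e2 : ‖e x - a‖ ≤ ‖e x - c‖ + ‖c - a‖ := by
      rw [show e x - a = (e x - c) + (c - a) by ring]; exact norm_add_le _ _
    linarith
  refine hVc.induction₂ (fun b b' => ∃ s ∈ B, (∀ x, s x ^ 2 * (e x - b) = e x - b') ∧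
    ∀ x, 4 * δ ≤ ‖e x - a‖ → 0 < (s x).re) ?_ ?_ ?_ hb hb'
  · intro c hc
    obtain ⟨u, huB, hu⟩ := aux_inv_mem e B hB heB hcon c (hV hc).1
    obtain ⟨ρ, hρ, hsqrt⟩ := aux_sqrt B hB
    have : ∀ᶠ d in nhds c, ‖(d - c) • u‖ < ρ := by
      have hc : ContinuousAt (fun d : ℂ => ‖(d - c) • u‖) c :=
        Continuous.continuousAt (by fun_prop)
      exact hc.eventually_lt (continuousAt_const (y := ρ)) (by simpa using hρ)
    filter_upwards [nhdsWithin_le_nhds this] with d hd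
    obtain ⟨s, hsB, hs, hs1⟩ := hsqrt _ (B.smul_mem huB (d - c)) hd
    refine ⟨s, hsB, fun x => ?_, fun x _ => ?_⟩
    · have := congrArg (fun f : C(X, ℂ) => f x) hs
      simp at this
      linear_combination (e x - c) * this - (d - c) * hu x
    · have h1 := ((s - 1).norm_coe_le_norm x).trans_lt hs1
      have h2 := (abs_lt.1 ((Complex.abs_re_le_norm _).trans_lt h1)).1
      simp at h2
      exact h2
  · rintro c d f hc hd hf ⟨s, hsB, hs, hs'⟩ ⟨t, htB, ht, ht'⟩
    refine ⟨s * t, B.mul_mem hsB htB, fun x => ?_, fun x hx => ?_⟩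
    · simp only [ContinuousMap.mul_apply]
      linear_combination t x ^ 2 * hs x + ht x
    · exact aux_re_mul_pos _ _ (hs' x hx) (ht' x hx) (hsq c hc d hd s hs x hx)
        (hsq d hd f hf t ht x hx)
  · rintro c d hc hd ⟨s, hsB, hs, hs'⟩
    obtain ⟨u, huB, hu⟩ := aux_inv_mem e B hB heB hcon d (hV hd).1
    have hinv : ∀ x, (s * u * (e - algebraMap ℂ C(X, ℂ) c)) x = (s x)⁻¹ := by
      intro x
      have hs0 : s x ≠ 0 := by
        intro h0
        have := hs x
        rw [h0] at this
        exact hne d hd x (by simpa using this.symm)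
      apply eq_inv_of_mul_eq_one_left
      simp [Algebra.algebraMap_eq_smul_one]
      linear_combination u x * hs x + hu x
    refine ⟨s * u * (e - algebraMap ℂ C(X, ℂ) c), B.mul_mem (B.mul_mem hsB huB)
      (B.sub_mem heB (B.algebraMap_mem c)), fun x => ?_, fun x hx => ?_⟩
    · rw [hinv, ← hs x]
      have hs0 : s x ≠ 0 := by
        intro h0
        have := hs x
        rw [h0] at this
        exact hne d hd x (by simpa using this.symm)
      field_simp
    · rw [hinv, Complex.inv_re]
      have := hs' x hx
      exact div_pos this (Complex.normSq_pos.2 (fun h => by rw [h] at this; simp at this))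


theorem aux_g_near (z a b r : ℂ) (δ : ℝ) (hδ : 0 < δ) (hab : ‖b - a‖ < δ) (hab' : δ / 2 ≤ ‖b - a‖)
    (hr : r ^ 2 * (z - a) = z - b) (hz : ‖z - a‖ < 4 * δ) :
    ‖(2 / ((a - b) / 2) ^ 2) * (z - (a + b) / 2 - (z - a) * r)‖ ≤ 400 / δ := by
  have h1 : ‖z - b‖ < 5 * δ := by
    rw [show z - b = (z - a) - (b - a) by ring]
    exact (norm_sub_le _ _).trans_lt (by linarith)
  have h2 : ‖(z - a) * r‖ ≤ 5 * δ := by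
    have : ‖(z - a) * r‖ ^ 2 = ‖z - a‖ * ‖z - b‖ := by
      rw [← norm_pow, ← norm_mul, ← hr]; congr 1; ring
    have h3 : ‖z - a‖ * ‖z - b‖ ≤ 4 * δ * (5 * δ) :=
      mul_le_mul hz.le h1.le (norm_nonneg _) (by positivity)
    apply (pow_le_pow_iff_left₀ (norm_nonneg _) (by positivity) two_ne_zero).1
    nlinarith
  have h3 : ‖z - (a + b) / 2‖ ≤ 5 * δ := by
    rw [show z - (a + b) / 2 = (1 / 2 : ℂ) * (z - a) + (1 / 2 : ℂ) * (z - b) by ring]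
    refine (norm_add_le _ _).trans ?_
    simp only [norm_mul]
    norm_num
    linarith
  have h4 : ‖z - (a + b) / 2 - (z - a) * r‖ ≤ 10 * δ := (norm_sub_le _ _).trans (by linarith)
  rw [norm_mul, norm_div, norm_pow, norm_div, norm_sub_rev a b]
  simp only [Complex.norm_ofNat]
  have h5 : 0 < ‖b - a‖ := by linarith
  have h6 : 2 / (‖b - a‖ / 2) ^ 2 ≤ 32 / δ ^ 2 := by
    rw [div_le_div_iff₀ (by positivity) (by positivity)]
    nlinarith
  calc _ ≤ 32 / δ ^ 2 * (10 * δ) := mul_le_mul h6 h4 (norm_nonneg _) (by positivity)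
    _ = 320 / δ := by field_simp; norm_num
    _ ≤ 400 / δ := by gcongr; norm_num

theorem aux_g_far (z a b r : ℂ) (δ : ℝ) (hδ : 0 < δ) (hab : ‖b - a‖ < δ) (hab' : δ / 2 ≤ ‖b - a‖)
    (hr : r ^ 2 * (z - a) = z - b) (hz : 4 * δ ≤ ‖z - a‖) (hre : 0 < r.re) :
    ‖(2 / ((a - b) / 2) ^ 2) * (z - (a + b) / 2 - (z - a) * r) - (z - a)⁻¹‖
      ≤ 2 * δ / ‖z - a‖ ^ 2 := by
  have hs : 0 < ‖z - a‖ := by linarith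
  have hza : z - a ≠ 0 := norm_pos_iff.1 hs
  have hba : b - a ≠ 0 := norm_pos_iff.1 (by linarith)
  have hab0 : a - b ≠ 0 := by rw [← neg_sub]; exact neg_ne_zero.2 hba
  set q : ℂ := (b - a) / (z - a) with hq
  have hqn : ‖q‖ ≤ 1 / 4 := by
    rw [hq, norm_div, div_le_iff₀ hs]; linarith
  have hr2 : r ^ 2 = 1 - q := by
    rw [hq, eq_sub_iff_add_eq, ← mul_left_inj' hza, add_mul, hr]; field_simp; ring
  have h1r : 1 ≤ ‖1 + r‖ := by
    refine le_trans ?_ (Complex.re_le_norm _)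
    simp; exact hre.le
  have hr1 : ‖1 - r‖ ≤ ‖q‖ := by
    have : ‖1 - r‖ * ‖1 + r‖ = ‖q‖ := by
      rw [← norm_mul]; congr 1; linear_combination hr2 * (-1)
    nlinarith [norm_nonneg (1 - r)]
  -- denominator
  set D : ℂ := 1 - q / 2 + r with hD
  have hDn : 7 / 8 ≤ ‖D‖ := by
    refine le_trans ?_ (Complex.re_le_norm _)
    have h := (abs_le.1 ((Complex.abs_re_le_norm (q / 2)))).2
    rw [norm_div] at h
    simp only [Complex.norm_ofNat] at h
    have : D.re = 1 - (q / 2).re + r.re := by rw [hD]; simp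
    rw [this]; linarith
  have hD0 : D ≠ 0 := norm_pos_iff.1 (by linarith)
  have hq0 : q ≠ 0 := div_ne_zero hba hza
  have hbq : b = a + q * (z - a) := by rw [hq]; field_simp; ring
  have hg : (2 / ((a - b) / 2) ^ 2) * (z - (a + b) / 2 - (z - a) * r) = 2 / (D * (z - a)) := by
    have h1 : (a - b) ^ 2 = q ^ 2 * (z - a) ^ 2 := by rw [hbq]; ring
    have h2 : z - (a + b) / 2 - (z - a) * r = (z - a) * (1 - q / 2 - r) := by rw [hbq]; ring
    have h3 : (1 - q / 2 - r) * D = q ^ 2 / 4 := by rw [hD]; linear_combination -hr2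
    rw [div_pow, h1, h2]
    field_simp
    linear_combination 4 * h3
  rw [hg, show 2 / (D * (z - a)) - (z - a)⁻¹ = (2 - D) / D / (z - a) by field_simp, norm_div,
    norm_div]
  have h2D : ‖2 - D‖ ≤ 3 / 2 * ‖q‖ := by
    rw [show 2 - D = (1 - r) + (1 / 2 : ℂ) * q by rw [hD]; ring]
    refine (norm_add_le _ _).trans ?_
    rw [norm_mul]; norm_num; linarith
  have hqd : ‖q‖ ≤ δ / ‖z - a‖ := by rw [hq, norm_div]; gcongr
  have h5 : ‖2 - D‖ / ‖D‖ ≤ 2 * δ / ‖z - a‖ := by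
    rw [div_le_iff₀ (by linarith)]
    have : 0 ≤ δ / ‖z - a‖ := by positivity
    rw [mul_div_assoc]
    nlinarith
  rw [pow_two, ← div_div]
  gcongr

theorem aux_g {X : Type*} [TopologicalSpace X] [CompactSpace X]
    (e : C(X, ℂ)) (B : Subalgebra ℂ C(X, ℂ)) (hB : IsClosed (B : Set C(X, ℂ))) (heB : e ∈ B)
    (hcon : IsPreconnected (Set.range e)ᶜ) (hemp : interior (Set.range e) = ∅) (p : ℂ) (δ : ℝ)
    (hδ : 0 < δ) :
    ∃ a : ℂ, ‖a - p‖ < δ ∧ ∃ g ∈ B, (∀ x, ‖e x - a‖ < 4 * δ → ‖g x‖ ≤ 400 / δ) ∧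
      ∀ x, 4 * δ ≤ ‖e x - a‖ → ‖g x - (e x - a)⁻¹‖ ≤ 2 * δ / ‖e x - a‖ ^ 2 := by
  have hK : IsCompact (Set.range e) := isCompact_range e.continuous
  have hdense : Dense (Set.range e)ᶜ := interior_eq_empty_iff_dense_compl.1 hemp
  obtain ⟨a, haK, hap⟩ := hdense.exists_dist_lt p hδ
  rw [dist_comm, dist_eq_norm] at hap
  refine ⟨a, hap, ?_⟩
  obtain ⟨b, hbV, hb⟩ := aux_component_far _ hK hcon a haK δ hδ
  have hVs := connectedComponentIn_subset ((Set.range e)ᶜ ∩ Metric.ball a δ) a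
  have hbδ : ‖b - a‖ < δ := by
    have := (hVs hbV).2
    rwa [Metric.mem_ball, dist_eq_norm] at this
  obtain ⟨r, hrB, hr, hr'⟩ := aux_branch e B hB heB hcon a δ hδ _
    isPreconnected_connectedComponentIn hVs a b
    (mem_connectedComponentIn ⟨haK, Metric.mem_ball_self hδ⟩) hbV
  refine ⟨(2 / ((a - b) / 2) ^ 2) • (e - algebraMap ℂ C(X, ℂ) ((a + b) / 2) -
    (e - algebraMap ℂ C(X, ℂ) a) * r), B.smul_mem (B.sub_mem (B.sub_mem heB (B.algebraMap_mem _))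
    (B.mul_mem (B.sub_mem heB (B.algebraMap_mem _)) hrB)) _, fun x hx => ?_, fun x hx => ?_⟩
  · simpa [Algebra.algebraMap_eq_smul_one] using aux_g_near (e x) a b (r x) δ hδ hbδ hb (hr x) hx
  · simpa [Algebra.algebraMap_eq_smul_one] using
      aux_g_far (e x) a b (r x) δ hδ hbδ hb (hr x) hx (hr' x hx)


theorem aux_disc_iff (u : ℂ) (R r : ℝ) (hu : ‖u‖ < R) (hr : 0 < r) :
    ‖u - r‖ < R ↔ r < u.re + Real.sqrt (R ^ 2 - u.im ^ 2) := by
  have hR : 0 < R := (norm_nonneg _).trans_lt hu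
  have h1 : u.re ^ 2 + u.im ^ 2 < R ^ 2 := by
    have := (sq_lt_sq₀ (norm_nonneg _) hR.le).2 hu
    rw [Complex.sq_norm, Complex.normSq_apply] at this
    nlinarith
  have hs : u.re ^ 2 < R ^ 2 - u.im ^ 2 := by linarith
  have h2 : |u.re| < Real.sqrt (R ^ 2 - u.im ^ 2) := Real.lt_sqrt_of_sq_lt (by rwa [sq_abs])
  have h3 : (‖u - r‖ < R) ↔ (r - u.re) ^ 2 < R ^ 2 - u.im ^ 2 := by
    rw [← sq_lt_sq₀ (norm_nonneg _) hR.le, Complex.sq_norm, Complex.normSq_apply]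
    simp
    constructor <;> intro h <;> nlinarith
  rw [h3]
  set S := Real.sqrt (R ^ 2 - u.im ^ 2) with hS
  have hS2 : S ^ 2 = R ^ 2 - u.im ^ 2 := Real.sq_sqrt (by nlinarith)
  have hS0 : 0 ≤ S := Real.sqrt_nonneg _
  have h4 := abs_lt.1 h2
  rw [← hS2]
  constructor
  · intro h
    linarith [(abs_lt.1 (abs_lt_of_sq_lt_sq h hS0)).2]
  · intro h
    apply sq_lt_sq'
    · linarith
    · linarith

theorem aux_inner (z : ℂ) (R : ℝ) (hz : ‖z‖ < R) (θ : ℝ) :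
    ∫ r in Set.Ioi (0:ℝ), {r : ℝ | ‖z - r * Complex.exp (θ * Complex.I)‖ < R}.indicator
      (fun _ => Complex.exp (-(θ * Complex.I))) r =
    ((z * Complex.exp (-(θ * Complex.I))).re +
      Real.sqrt (R ^ 2 - (z * Complex.exp (-(θ * Complex.I))).im ^ 2) : ℝ) *
        Complex.exp (-(θ * Complex.I)) := by
  set u := z * Complex.exp (-(θ * Complex.I)) with hu
  have hn : ‖Complex.exp (-(θ * Complex.I))‖ = 1 := by
    rw [← neg_mul, ← Complex.ofReal_neg]; exact Complex.norm_exp_ofReal_mul_I _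
  have hun : ‖u‖ < R := by rw [hu, norm_mul, hn, mul_one]; exact hz
  have h1 : ∀ r : ℝ, ‖z - r * Complex.exp (θ * Complex.I)‖ = ‖u - r‖ := by
    intro r
    rw [← mul_one ‖z - _‖, ← hn, ← norm_mul, sub_mul, mul_assoc, ← Complex.exp_add]
    simp [hu]
  set ρ := u.re + Real.sqrt (R ^ 2 - u.im ^ 2) with hρ
  have hρ0 : 0 ≤ ρ := by
    have h1 : |u.re| ≤ Real.sqrt (R ^ 2 - u.im ^ 2) := by
      apply Real.le_sqrt_of_sq_le
      have hR : 0 < R := (norm_nonneg _).trans_lt hun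
      have := (sq_lt_sq₀ (norm_nonneg _) hR.le).2 hun
      rw [Complex.sq_norm, Complex.normSq_apply] at this
      rw [sq_abs]
      nlinarith
    linarith [neg_abs_le u.re]
  have h2 : Set.EqOn ({r : ℝ | ‖z - r * Complex.exp (θ * Complex.I)‖ < R}.indicator
      (fun _ => Complex.exp (-(θ * Complex.I)))) ((Set.Iio ρ).indicator
      (fun _ => Complex.exp (-(θ * Complex.I)))) (Set.Ioi 0) := by
    intro r hr
    have : (r ∈ {r : ℝ | ‖z - r * Complex.exp (θ * Complex.I)‖ < R}) ↔ r ∈ Set.Iio ρ := by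
      rw [Set.mem_ofPred_eq, h1, aux_disc_iff u R r hun hr]; rfl
    by_cases h : r ∈ Set.Iio ρ
    · rw [Set.indicator_of_mem h, Set.indicator_of_mem (this.2 h)]
    · rw [Set.indicator_of_notMem h, Set.indicator_of_notMem (fun h' => h (this.1 h'))]
  rw [MeasureTheory.setIntegral_congr_fun measurableSet_Ioi h2,
    MeasureTheory.setIntegral_indicator measurableSet_Iio, Set.Ioi_inter_Iio,
    MeasureTheory.setIntegral_const]
  simp [hρ0]

theorem aux_antiperiodic (F : ℝ → ℂ) (hF : Continuous F) (h : ∀ θ, F (θ + Real.pi) = - F θ) :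
    ∫ θ in (-Real.pi)..Real.pi, F θ = 0 := by
  have h1 := intervalIntegral.integral_add_adjacent_intervals
    (hF.intervalIntegrable (μ := MeasureTheory.volume) (-Real.pi) 0)
    (hF.intervalIntegrable (μ := MeasureTheory.volume) 0 Real.pi)
  have h2 := intervalIntegral.integral_comp_add_right (a := -Real.pi) (b := 0) F Real.pi
  simp only [h, neg_add_cancel, zero_add, intervalIntegral.integral_neg] at h2
  rw [← h1, ← h2]; ring

theorem aux_theta (z : ℂ) (R : ℝ) :
    ∫ θ in (-Real.pi)..Real.pi, (((z * Complex.exp (-(θ * Complex.I))).re +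
      Real.sqrt (R ^ 2 - (z * Complex.exp (-(θ * Complex.I))).im ^ 2) : ℝ) *
        Complex.exp (-(θ * Complex.I)) : ℂ) = Real.pi * (starRingEnd ℂ) z := by
  have hexp : ∀ θ : ℝ, Complex.exp (-((θ + Real.pi : ℝ) * Complex.I)) =
      - Complex.exp (-(θ * Complex.I)) := by
    intro θ
    push_cast
    rw [add_mul, neg_add, Complex.exp_add, Complex.exp_neg (Real.pi * Complex.I),
      Complex.exp_pi_mul_I]
    norm_num
  have h1 : ∫ θ in (-Real.pi)..Real.pi,
      ((Real.sqrt (R ^ 2 - (z * Complex.exp (-(θ * Complex.I))).im ^ 2) : ℝ) *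
        Complex.exp (-(θ * Complex.I)) : ℂ) = 0 := by
    apply aux_antiperiodic
    · fun_prop
    · intro θ
      rw [hexp, mul_neg z, Complex.neg_im, neg_sq]
      ring
  have h2 : ∫ θ in (-Real.pi)..Real.pi, Complex.exp (-2 * Complex.I * θ) = 0 := by
    rw [integral_exp_mul_complex (by simp)]
    have : Complex.exp (-2 * Complex.I * (Real.pi : ℝ)) = 1 := by
      rw [show (-2 * Complex.I * (Real.pi : ℝ) : ℂ) = -(2 * Real.pi * Complex.I) by ring,
        Complex.exp_neg, Complex.exp_two_pi_mul_I, inv_one]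
    have h' : Complex.exp (-2 * Complex.I * ((-Real.pi : ℝ) : ℂ)) = 1 := by
      rw [show (-2 * Complex.I * ((-Real.pi : ℝ) : ℂ) : ℂ) = (2 * Real.pi * Complex.I) by
        push_cast; ring, Complex.exp_two_pi_mul_I]
    rw [this, h']; simp
  have h3 : ∀ θ : ℝ, (((z * Complex.exp (-(θ * Complex.I))).re +
      Real.sqrt (R ^ 2 - (z * Complex.exp (-(θ * Complex.I))).im ^ 2) : ℝ) *
        Complex.exp (-(θ * Complex.I)) : ℂ) =
      (z / 2 * Complex.exp (-2 * Complex.I * θ) + (starRingEnd ℂ) z / 2) +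
      ((Real.sqrt (R ^ 2 - (z * Complex.exp (-(θ * Complex.I))).im ^ 2) : ℝ) *
        Complex.exp (-(θ * Complex.I)) : ℂ) := by
    intro θ
    rw [Complex.ofReal_add, add_mul]
    congr 1
    rw [Complex.re_eq_add_conj, map_mul, ← Complex.exp_conj]
    simp only [map_neg, map_mul, Complex.conj_ofReal, Complex.conj_I]
    have e1 : Complex.exp (-(θ * -Complex.I)) * Complex.exp (-(θ * Complex.I)) = 1 := by
      rw [← Complex.exp_add]; simp
    have e2 : Complex.exp (-2 * Complex.I * θ) =
        Complex.exp (-(θ * Complex.I)) * Complex.exp (-(θ * Complex.I)) := by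
      rw [← Complex.exp_add]; ring_nf
    rw [e2]
    linear_combination (starRingEnd ℂ) z / 2 * e1
  simp_rw [h3]
  rw [intervalIntegral.integral_add, h1, intervalIntegral.integral_add,
    intervalIntegral.integral_const_mul, h2, intervalIntegral.integral_const]
  · simp; ring
  all_goals exact Continuous.intervalIntegrable (by fun_prop) _ _

theorem aux_cauchy (z : ℂ) (R : ℝ) (hz : ‖z‖ < R) :
    ∫ ζ in Metric.ball (0:ℂ) R, (z - ζ)⁻¹ = Real.pi * (starRingEnd ℂ) z := by
  have e1 : ∫ ζ in Metric.ball (0:ℂ) R, (z - ζ)⁻¹ =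
      ∫ w, {w : ℂ | ‖z - w‖ < R}.indicator (fun w => w⁻¹) w := by
    rw [← MeasureTheory.integral_indicator measurableSet_ball,
      ← MeasureTheory.integral_sub_left_eq_self _ _ z]
    congr 1
    ext ζ
    by_cases h : ‖z - ζ‖ < R
    · rw [Set.indicator_of_mem (by simpa using h), Set.indicator_of_mem (by exact h)]
      simp
    · rw [Set.indicator_of_notMem (by simpa using h), Set.indicator_of_notMem (by exact h)]
  have hmeas : MeasurableSet {p : ℝ × ℝ | ‖z - p.1 * Complex.exp (p.2 * Complex.I)‖ < R} :=
    (isOpen_lt (by fun_prop) continuous_const).measurableSet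
  have e2 : Set.EqOn (fun p : ℝ × ℝ => p.1 • {w : ℂ | ‖z - w‖ < R}.indicator (fun w => w⁻¹)
        (Complex.polarCoord.symm p))
      ({p : ℝ × ℝ | ‖z - p.1 * Complex.exp (p.2 * Complex.I)‖ < R}.indicator
        (fun p => Complex.exp (-(p.2 * Complex.I)))) polarCoord.target := by
    rintro ⟨r, θ⟩ ⟨hr, -⟩
    have hr' : (r : ℂ) ≠ 0 := by
      have : (0:ℝ) < r := hr
      exact_mod_cast this.ne'
    have hp : Complex.polarCoord.symm (r, θ) = r * Complex.exp (θ * Complex.I) := by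
      rw [Complex.polarCoord_symm_apply, Complex.exp_mul_I]; simp
    simp only [hp]
    by_cases h : ‖z - r * Complex.exp (θ * Complex.I)‖ < R
    · rw [Set.indicator_of_mem (by exact h), Set.indicator_of_mem (by exact h)]
      rw [mul_inv, Complex.exp_neg, Complex.real_smul, mul_inv_cancel_left₀ hr']
    · rw [Set.indicator_of_notMem (by exact h), Set.indicator_of_notMem (by exact h), smul_zero]
  rw [e1, ← Complex.integral_comp_polarCoord_symm,
    MeasureTheory.setIntegral_congr_fun polarCoord.open_target.measurableSet e2]
  rw [polarCoord_target, MeasureTheory.Measure.volume_eq_prod, ← MeasureTheory.Measure.prod_restrict,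
    MeasureTheory.integral_prod_symm]
  · rw [← aux_theta z R, intervalIntegral.integral_of_le (by linarith [Real.pi_pos]),
      MeasureTheory.integral_Ioc_eq_integral_Ioo]
    congr 1
    ext θ
    rw [← aux_inner z R hz θ]
    rfl
  · rw [MeasureTheory.Measure.prod_restrict, MeasureTheory.integrable_indicator_iff hmeas,
      MeasureTheory.IntegrableOn, MeasureTheory.Measure.restrict_restrict hmeas]
    refine MeasureTheory.Measure.integrableOn_of_bounded (M := 1) ?_ ?_ ?_
    · refine (MeasureTheory.measure_mono (t := Set.Icc 0 (2 * R) ×ˢ Set.Icc (-Real.pi) Real.pi) ?_).trans_lt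
        (isCompact_Icc.prod isCompact_Icc).measure_lt_top |>.ne
      rintro ⟨r, θ⟩ ⟨h1, h2, h3⟩
      refine ⟨⟨le_of_lt h2, ?_⟩, h3.1.le, h3.2.le⟩
      have h2' : (0:ℝ) < r := h2
      have h1' : ‖z - r * Complex.exp (θ * Complex.I)‖ < R := h1
      have : ‖(r * Complex.exp (θ * Complex.I) : ℂ)‖ = r := by
        rw [norm_mul, Complex.norm_exp_ofReal_mul_I, mul_one, Complex.norm_real,
          Real.norm_of_nonneg h2'.le]
      have h4 := norm_sub_norm_le (r * Complex.exp (θ * Complex.I) : ℂ) z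
      rw [norm_sub_rev, this] at h4
      simp only
      linarith
    · exact (by fun_prop : Continuous fun p : ℝ × ℝ => Complex.exp (-(p.2 * Complex.I))).aestronglyMeasurable
    · refine Filter.Eventually.of_forall fun p => ?_
      rw [← neg_mul, ← Complex.ofReal_neg]; exact (Complex.norm_exp_ofReal_mul_I _).le


theorem aux_kernel_int (r : ℝ) :
    MeasureTheory.Integrable ((Metric.ball (0:ℂ) r).indicator
      (fun w : ℂ => (‖w‖ * Real.sqrt ‖w‖)⁻¹)) := by
  rw [MeasureTheory.integrable_indicator_iff measurableSet_ball]
  have := (MeasureTheory.integrableOn_fun_norm_addHaar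
    (μ := (MeasureTheory.volume : MeasureTheory.Measure ℂ))
    (f := fun y : ℝ => (y * Real.sqrt y)⁻¹) (r := r)).2
  apply this
  rw [Complex.finrank_real_complex]
  rcases le_or_gt r 0 with hr | hr
  · rw [Set.Ioo_eq_empty (by linarith)]; simp
  have h2 := (intervalIntegral.integrableOn_Ioo_rpow_iff (s := -(1/2 : ℝ)) hr).2 (by norm_num)
  refine h2.congr_fun ?_ measurableSet_Ioo
  intro y hy
  have hy0 : 0 < y := hy.1
  have hs : 0 < Real.sqrt y := Real.sqrt_pos.2 hy0
  simp only
  rw [Real.rpow_neg hy0.le, ← Real.sqrt_eq_rpow]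
  simp
  field_simp

theorem aux_near_bound (s δ : ℝ) (hs : 0 < s) (hδ : 0 < δ) (h : s ≤ 6 * δ) :
    400 / δ + 1 / s ≤ 8000 * Real.sqrt δ * (s * Real.sqrt s)⁻¹ := by
  have hd : 0 < Real.sqrt δ := Real.sqrt_pos.2 hδ
  have ht : 0 < Real.sqrt s := Real.sqrt_pos.2 hs
  have hd2 : Real.sqrt δ ^ 2 = δ := Real.sq_sqrt hδ.le
  have ht2 : Real.sqrt s ^ 2 = s := Real.sq_sqrt hs.le
  set d := Real.sqrt δ
  set t := Real.sqrt s
  have htd : t ≤ 3 * d := by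
    apply (pow_le_pow_iff_left₀ ht.le (by positivity) two_ne_zero).1
    nlinarith
  have h1 : 400 / δ ≤ 7200 * d * (s * t)⁻¹ := by
    rw [← div_eq_mul_inv, div_le_div_iff₀ hδ (by positivity)]
    have : s * t ≤ 6 * δ * (3 * d) := mul_le_mul h htd ht.le (by positivity)
    nlinarith
  have h2 : 1 / s ≤ 3 * d * (s * t)⁻¹ := by
    rw [← div_eq_mul_inv, div_le_div_iff₀ hs (by positivity)]
    nlinarith
  have h3 : 0 ≤ d * (s * t)⁻¹ := by positivity
  nlinarith

theorem aux_far_bound (s δ : ℝ) (hs : 0 < s) (hδ : 0 < δ) (h : δ ≤ s) :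
    8 * δ / s ^ 2 ≤ 8000 * Real.sqrt δ * (s * Real.sqrt s)⁻¹ := by
  have hd : 0 < Real.sqrt δ := Real.sqrt_pos.2 hδ
  have ht : 0 < Real.sqrt s := Real.sqrt_pos.2 hs
  have hdt : Real.sqrt δ ≤ Real.sqrt s := Real.sqrt_le_sqrt h
  have hd2 : Real.sqrt δ ^ 2 = δ := Real.sq_sqrt hδ.le
  have ht2 : Real.sqrt s ^ 2 = s := Real.sq_sqrt hs.le
  set d := Real.sqrt δ
  set t := Real.sqrt s
  rw [← div_eq_mul_inv, div_le_div_iff₀ (by positivity) (by positivity), ← hd2, ← ht2]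
  have h1 : d * (d * t ^ 3) ≤ t * (d * t ^ 3) := mul_le_mul_of_nonneg_right hdt (by positivity)
  have h2 : 0 ≤ d * t ^ 4 := by positivity
  nlinarith

/-- pointwise comparison of the corrected kernel with the Cauchy kernel -/
theorem aux_pointwise (z a ζ g : ℂ) (δ : ℝ) (hδ : 0 < δ) (ha : ‖a - ζ‖ < 2 * δ) (hz : z ≠ ζ)
    (hnear : ‖z - a‖ < 4 * δ → ‖g‖ ≤ 400 / δ)
    (hfar : 4 * δ ≤ ‖z - a‖ → ‖g - (z - a)⁻¹‖ ≤ 2 * δ / ‖z - a‖ ^ 2) :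
    ‖g - (z - ζ)⁻¹‖ ≤ 8000 * Real.sqrt δ * (‖z - ζ‖ * Real.sqrt ‖z - ζ‖)⁻¹ := by
  have hz0 : z - ζ ≠ 0 := sub_ne_zero.2 hz
  have hs : 0 < ‖z - ζ‖ := norm_pos_iff.2 hz0
  have ht1 : ‖z - ζ‖ ≤ ‖z - a‖ + ‖a - ζ‖ := by
    rw [show z - ζ = (z - a) + (a - ζ) by ring]; exact norm_add_le _ _
  have ht2 : ‖z - a‖ ≤ ‖z - ζ‖ + ‖a - ζ‖ := by
    rw [show z - a = (z - ζ) - (a - ζ) by ring]; exact norm_sub_le _ _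
  rcases lt_or_ge ‖z - a‖ (4 * δ) with h | h
  · refine le_trans ?_ (aux_near_bound _ δ hs hδ (by linarith))
    refine (norm_sub_le _ _).trans ?_
    rw [norm_inv, one_div]
    linarith [hnear h]
  · refine le_trans ?_ (aux_far_bound _ δ hs hδ (by linarith))
    have hq : 0 < ‖z - a‖ := by linarith
    have hza : z - a ≠ 0 := norm_pos_iff.1 hq
    have hsq : ‖z - ζ‖ ≤ 3 / 2 * ‖z - a‖ := by linarith
    have e1 : ‖(z - a)⁻¹ - (z - ζ)⁻¹‖ ≤ 3 * δ / ‖z - ζ‖ ^ 2 := by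
      rw [show (z - a)⁻¹ - (z - ζ)⁻¹ = (a - ζ) / ((z - a) * (z - ζ)) by field_simp; ring, norm_div,
        norm_mul]
      rw [div_le_div_iff₀ (by positivity) (by positivity)]
      have : ‖a - ζ‖ * ‖z - ζ‖ ≤ 2 * δ * (3 / 2 * ‖z - a‖) :=
        mul_le_mul ha.le hsq hs.le (by positivity)
      nlinarith
    have e2 : 2 * δ / ‖z - a‖ ^ 2 ≤ 5 * δ / ‖z - ζ‖ ^ 2 := by
      rw [div_le_div_iff₀ (by positivity) (by positivity)]
      have : ‖z - ζ‖ ^ 2 ≤ (3 / 2 * ‖z - a‖) ^ 2 := pow_le_pow_left₀ hs.le hsq 2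
      nlinarith
    rw [show g - (z - ζ)⁻¹ = (g - (z - a)⁻¹) + ((z - a)⁻¹ - (z - ζ)⁻¹) by ring]
    refine (norm_add_le _ _).trans ?_
    have : 8 * δ / ‖z - ζ‖ ^ 2 = 5 * δ / ‖z - ζ‖ ^ 2 + 3 * δ / ‖z - ζ‖ ^ 2 := by ring
    linarith [hfar h]

theorem aux_inv_int (z : ℂ) (R : ℝ) (hz : ‖z‖ < R) :
    MeasureTheory.IntegrableOn (fun ζ : ℂ => (z - ζ)⁻¹) (Metric.ball 0 R) := by
  have h := ((aux_kernel_int (2 * R)).comp_sub_left z).const_mul (Real.sqrt (2 * R))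
  refine MeasureTheory.Integrable.mono' (h.integrableOn (s := Metric.ball 0 R))
    (Measurable.aestronglyMeasurable (by fun_prop)) ?_
  refine (MeasureTheory.ae_restrict_iff' measurableSet_ball).2 (Filter.Eventually.of_forall ?_)
  intro ζ hζ
  have hζ' : ‖ζ‖ < R := by simpa using hζ
  have h1 : ‖z - ζ‖ < 2 * R := (norm_sub_le _ _).trans_lt (by linarith)
  rw [Set.indicator_of_mem (by simpa using h1), norm_inv]
  rcases eq_or_ne (z - ζ) 0 with h0 | h0
  · simp [h0]
  have hs : 0 < ‖z - ζ‖ := norm_pos_iff.2 h0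
  have ht : 0 < Real.sqrt ‖z - ζ‖ := Real.sqrt_pos.2 hs
  rw [← div_eq_mul_inv, inv_eq_one_div, div_le_div_iff₀ hs (by positivity)]
  have := Real.sqrt_le_sqrt h1.le
  nlinarith

theorem aux_grid (ζ : ℂ) (δ : ℝ) (hδ : 0 < δ) :
    ‖(⟨δ / 2 * ⌊ζ.re / (δ / 2)⌋, δ / 2 * ⌊ζ.im / (δ / 2)⌋⟩ : ℂ) - ζ‖ < δ := by
  have key : ∀ t : ℝ, |δ / 2 * ⌊t / (δ / 2)⌋ - t| ≤ δ / 2 ∧ 0 ≤ t - δ / 2 * ⌊t / (δ / 2)⌋ ∧ t - δ / 2 * ⌊t / (δ / 2)⌋ < δ / 2 := by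
    intro t
    have h1 := Int.floor_le (t / (δ / 2))
    have h2 := Int.lt_floor_add_one (t / (δ / 2))
    rw [le_div_iff₀ (by positivity)] at h1
    rw [div_lt_iff₀ (by positivity)] at h2
    refine ⟨abs_le.2 ⟨?_, ?_⟩, ?_, ?_⟩ <;> nlinarith
  refine (Complex.norm_le_abs_re_add_abs_im _).trans_lt ?_
  simp only [Complex.sub_re, Complex.sub_im]
  have h1 : |δ / 2 * ⌊ζ.re / (δ / 2)⌋ - ζ.re| < δ / 2 := by
    obtain ⟨-, h1, h2⟩ := key ζ.re
    rw [abs_lt]; constructor <;> linarith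
  linarith [(key ζ.im).1]

theorem aux_conj_approx {X : Type*} [TopologicalSpace X] [CompactSpace X]
    (e : C(X, ℂ)) (B : Subalgebra ℂ C(X, ℂ)) (hB : IsClosed (B : Set C(X, ℂ))) (heB : e ∈ B)
    (hcon : IsPreconnected (Set.range e)ᶜ) (hemp : interior (Set.range e) = ∅) (R : ℝ)
    (hR : ∀ x, ‖e x‖ < R) (δ : ℝ) (hδ : 0 < δ) :
    ∃ G ∈ B, ∀ x, ‖G x - Real.pi * (starRingEnd ℂ) (e x)‖ ≤ 8000 * Real.sqrt δ *
      ∫ w, (Metric.ball (0:ℂ) (2 * R)).indicator (fun w : ℂ => (‖w‖ * Real.sqrt ‖w‖)⁻¹) w := by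
  have : CompleteSpace B := hB.completeSpace_coe
  choose a ha g hgB hnear hfar using fun p : ℂ => aux_g e B hB heB hcon hemp p δ hδ
  let pt : ℤ × ℤ → ℂ := fun q => ⟨δ / 2 * q.1, δ / 2 * q.2⟩
  let q : ℂ → ℤ × ℤ := fun ζ => (⌊ζ.re / (δ / 2)⌋, ⌊ζ.im / (δ / 2)⌋)
  have hq : Measurable q := by
    refine Measurable.prodMk ?_ ?_
    · exact Int.measurable_floor.comp (Complex.measurable_re.div_const _)
    · exact Int.measurable_floor.comp (Complex.measurable_im.div_const _)
  let F : ℂ → B := fun ζ => ⟨g (pt (q ζ)), hgB _⟩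
  have hFm : MeasureTheory.StronglyMeasurable F :=
    (MeasureTheory.StronglyMeasurable.of_discrete
      (f := fun k : ℤ × ℤ => (⟨g (pt k), hgB _⟩ : B))).comp_measurable hq
  have hFb : ∀ ζ, ‖F ζ‖ ≤ 400 / δ := by
    intro ζ
    change ‖g (pt (q ζ))‖ ≤ _
    rw [ContinuousMap.norm_le _ (by positivity)]
    intro x
    rcases lt_or_ge ‖e x - a (pt (q ζ))‖ (4 * δ) with h | h
    · exact hnear _ x h
    · have h1 := hfar _ x h
      have h0 : 0 < ‖e x - a (pt (q ζ))‖ := by linarith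
      have h2 : 2 * δ / ‖e x - a (pt (q ζ))‖ ^ 2 ≤ 1 / δ := by
        rw [div_le_div_iff₀ (by positivity) hδ]; nlinarith
      have h3 : ‖(e x - a (pt (q ζ)))⁻¹‖ ≤ 1 / δ := by
        rw [norm_inv, inv_eq_one_div]
        exact one_div_le_one_div_of_le hδ (by linarith)
      have h4 : 1 / δ + 1 / δ ≤ 400 / δ := by
        rw [← add_div]; gcongr; norm_num
      calc _ = ‖(g (pt (q ζ)) x - (e x - a (pt (q ζ)))⁻¹) + (e x - a (pt (q ζ)))⁻¹‖ := by
            rw [sub_add_cancel]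
        _ ≤ _ := norm_add_le _ _
        _ ≤ _ := by linarith
  have hFi : MeasureTheory.IntegrableOn F (Metric.ball 0 R) :=
    MeasureTheory.Measure.integrableOn_of_bounded (M := 400 / δ) MeasureTheory.measure_ball_lt_top.ne
      hFm.aestronglyMeasurable (Filter.Eventually.of_forall hFb)
  refine ⟨(∫ ζ in Metric.ball 0 R, F ζ : B), Subtype.property _, fun x => ?_⟩
  let L : B →L[ℂ] ℂ := (ContinuousMap.evalCLM ℂ x).comp (Subalgebra.toSubmodule B).subtypeL
  have hL : ((∫ ζ in Metric.ball 0 R, F ζ : B) : C(X, ℂ)) x = ∫ ζ in Metric.ball 0 R, L (F ζ) :=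
    (L.integral_comp_comm hFi).symm
  rw [hL, ← aux_cauchy (e x) R (hR x), ← MeasureTheory.integral_sub (L.integrable_comp hFi)
    (aux_inv_int _ _ (hR x))]
  have hK := (((aux_kernel_int (2 * R)).comp_sub_left (e x)).const_mul (8000 * Real.sqrt δ))
  refine (MeasureTheory.norm_integral_le_of_norm_le (hK.integrableOn (s := Metric.ball 0 R)) ?_).trans
    ((MeasureTheory.setIntegral_le_integral hK ?_).trans ?_)
  · have hne : ∀ᵐ ζ : ℂ, e x ≠ ζ := by
      refine MeasureTheory.measure_mono_null (t := {e x}) ?_ (MeasureTheory.measure_singleton _)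
      intro ζ hζ
      simp at hζ
      simp [hζ]
    refine (MeasureTheory.ae_restrict_iff' measurableSet_ball).2 ?_
    filter_upwards [hne] with ζ hζne hζ
    have hζ' : ‖ζ‖ < R := by simpa using hζ
    have h1 : ‖e x - ζ‖ < 2 * R := (norm_sub_le _ _).trans_lt (by linarith [hR x])
    rw [Set.indicator_of_mem (by simpa using h1)]
    refine aux_pointwise (e x) (a (pt (q ζ))) ζ _ δ hδ ?_ hζne (hnear _ x) (hfar _ x)
    have h2 := aux_grid ζ δ hδ
    have h3 := ha (pt (q ζ))
    rw [show a (pt (q ζ)) - ζ = (a (pt (q ζ)) - pt (q ζ)) + (pt (q ζ) - ζ) by ring]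
    exact (norm_add_le _ _).trans_lt (by
      have : ‖pt (q ζ) - ζ‖ < δ := h2
      linarith)
  · refine Filter.Eventually.of_forall fun ζ => ?_
    exact mul_nonneg (by positivity) (Set.indicator_nonneg (fun _ _ => by positivity) _)
  · rw [MeasureTheory.integral_const_mul, MeasureTheory.integral_sub_left_eq_self
      (fun w => (Metric.ball (0:ℂ) (2 * R)).indicator (fun w : ℂ => (‖w‖ * Real.sqrt ‖w‖)⁻¹) w)]

theorem aux_star_mem {X : Type*} [TopologicalSpace X] [CompactSpace X]
    (e : C(X, ℂ)) (B : Subalgebra ℂ C(X, ℂ)) (hB : IsClosed (B : Set C(X, ℂ))) (heB : e ∈ B)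
    (hcon : IsPreconnected (Set.range e)ᶜ) (hemp : interior (Set.range e) = ∅) :
    star e ∈ B := by
  have hpi : ((Real.pi : ℂ)) ≠ 0 := by exact_mod_cast Real.pi_ne_zero
  suffices h : (Real.pi : ℂ) • star e ∈ B by
    have := B.smul_mem h (Real.pi : ℂ)⁻¹
    rwa [smul_smul, inv_mul_cancel₀ hpi, one_smul] at this
  have hR : ∀ x, ‖e x‖ < ‖e‖ + 1 := fun x => (e.norm_coe_le_norm x).trans_lt (by linarith)
  set M := ∫ w, (Metric.ball (0:ℂ) (2 * (‖e‖ + 1))).indicator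
    (fun w : ℂ => (‖w‖ * Real.sqrt ‖w‖)⁻¹) w with hM
  have hM0 : 0 ≤ M := MeasureTheory.integral_nonneg
    fun w => Set.indicator_nonneg (fun _ _ => by positivity) _
  rw [← SetLike.mem_coe, ← hB.closure_eq, Metric.mem_closure_iff]
  intro ε hε
  have hd : 0 < ε / (8000 * (M + 1)) := by positivity
  obtain ⟨G, hG, hGx⟩ := aux_conj_approx e B hB heB hcon hemp (‖e‖ + 1) hR
    ((ε / (8000 * (M + 1))) ^ 2) (by positivity)
  rw [← hM, Real.sqrt_sq hd.le] at hGx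
  refine ⟨G, hG, ?_⟩
  have hlt : 8000 * (ε / (8000 * (M + 1))) * M < ε := by
    have : 8000 * (ε / (8000 * (M + 1))) * M = ε * (M / (M + 1)) := by field_simp
    rw [this]
    have : M / (M + 1) < 1 := by rw [div_lt_one (by positivity)]; linarith
    nlinarith
  rw [dist_comm, dist_eq_norm]
  refine lt_of_le_of_lt ?_ hlt
  rw [ContinuousMap.norm_le _ (by positivity)]
  intro x
  simpa using hGx x

theorem aux_poly_approx {n : ℕ} (e : Fin n × unitInterval → ℂ) (he : Continuous e)
    (hinj : Function.Injective e) (F : Fin n × unitInterval → ℂ) (hF : Continuous F) (ε : ℝ)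
    (hε : 0 < ε) : ∃ p : ℂ[X], ∀ x, ‖p.eval (e x) - F x‖ < ε := by
  let E : C(Fin n × unitInterval, ℂ) := ⟨e, he⟩
  let B : Subalgebra ℂ C(Fin n × unitInterval, ℂ) := (Algebra.adjoin ℂ {E}).topologicalClosure
  have hB : IsClosed (B : Set C(Fin n × unitInterval, ℂ)) :=
    Subalgebra.isClosed_topologicalClosure _
  have hEB : E ∈ B := Subalgebra.le_topologicalClosure _ (Algebra.self_mem_adjoin_singleton ℂ E)
  have hstar : star E ∈ B := aux_star_mem E B hB hEB
    (aux_compl_preconnected e he hinj fun F hF h0 => aux_arc_log F hF h0)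
    (aux_arcs_interior e he hinj)
  have htop := ContinuousMap.starSubalgebra_topologicalClosure_eq_top_of_separatesPoints
    (StarAlgebra.adjoin ℂ {E}) (by
      intro x y hxy
      refine ⟨E, ⟨E, StarAlgebra.self_mem_adjoin_singleton ℂ E, rfl⟩, fun h => hxy (hinj h)⟩)
  have hsub : ∀ u ∈ StarAlgebra.adjoin ℂ {E}, u ∈ B := by
    intro u hu
    rw [← StarSubalgebra.mem_toSubalgebra, StarAlgebra.adjoin_toSubalgebra] at hu
    have : Algebra.adjoin ℂ ({E} ∪ star {E}) ≤ B := by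
      apply Algebra.adjoin_le
      rintro v (hv | hv)
      · rw [Set.mem_singleton_iff] at hv; rw [hv]; exact hEB
      · have : v = star E := by
          have h : star v = E := hv
          rw [← h, star_star]
        rw [this]; exact hstar
    exact this hu
  have hFB : (⟨F, hF⟩ : C(Fin n × unitInterval, ℂ)) ∈ B := by
    have h1 : (⟨F, hF⟩ : C(Fin n × unitInterval, ℂ)) ∈
        (StarAlgebra.adjoin ℂ {E}).topologicalClosure := by rw [htop]; trivial
    have h2 : (⟨F, hF⟩ : C(Fin n × unitInterval, ℂ)) ∈
        closure (StarAlgebra.adjoin ℂ {E} : Set C(Fin n × unitInterval, ℂ)) := h1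
    exact closure_minimal hsub hB h2
  have h3 : (⟨F, hF⟩ : C(Fin n × unitInterval, ℂ)) ∈
      closure (Algebra.adjoin ℂ {E} : Set C(Fin n × unitInterval, ℂ)) := hFB
  obtain ⟨G, hG, hGF⟩ := Metric.mem_closure_iff.1 h3 ε hε
  rw [SetLike.mem_coe, Algebra.adjoin_singleton_eq_range_aeval] at hG
  obtain ⟨p, rfl⟩ := hG
  refine ⟨p, fun x => ?_⟩
  have h4 := (ContinuousMap.dist_apply_le_dist x).trans_lt hGF
  rw [dist_comm, dist_eq_norm] at h4
  have h5 : (aeval E p) x = p.eval (e x) := by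
    have := Polynomial.aeval_continuousMap_apply p E x
    rw [this]; simp [E]
  change ‖(aeval E p) x - F x‖ < ε at h4
  rwa [h5] at h4


theorem aux_root_near {n : ℕ} (A : unitInterval → Matrix (Fin n) (Fin n) ℂ) (hA : Continuous A)
    (t₀ : unitInterval) (μ : ℂ) (hμ : μ ∈ spectrum ℂ (A t₀)) (r : ℝ) (hr : 0 < r) :
    ∀ᶠ t in nhds t₀, ∃ ν ∈ spectrum ℂ (A t), ‖ν - μ‖ < r := by
  have h0 : (A t₀).charpoly.eval μ = 0 := Matrix.mem_spectrum_iff_isRoot_charpoly.1 hμ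
  have hc : Continuous fun t => (A t).charpoly.eval μ := by
    simp_rw [Matrix.eval_charpoly]
    exact (continuous_const.sub hA).matrix_det
  have h1 : ∀ᶠ t in nhds t₀, ‖(A t).charpoly.eval μ‖ < r ^ n :=
    (hc.norm.continuousAt (x := t₀)).eventually_lt (continuousAt_const (y := r ^ n))
      (by rw [h0, norm_zero]; positivity)
  filter_upwards [h1] with t ht
  by_contra! hcon
  have hsp : (A t).charpoly.Splits := IsAlgClosed.splits _
  rw [hsp.eval_eq_prod_roots_of_monic (Matrix.charpoly_monic _)] at ht
  have hcard : Multiset.card (A t).charpoly.roots = n := by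
    rw [← hsp.natDegree_eq_card_roots, Matrix.charpoly_natDegree_eq_dim, Fintype.card_fin]
  have key : ∀ s : Multiset ℂ, (∀ ν ∈ s, r ≤ ‖ν - μ‖) →
      r ^ (Multiset.card s) ≤ ‖(s.map (μ - ·)).prod‖ := by
    intro s
    induction s using Multiset.induction_on with
    | empty => intro _; simp
    | cons a s ih =>
      intro h
      rw [Multiset.map_cons, Multiset.prod_cons, norm_mul, Multiset.card_cons, pow_succ, mul_comm]
      refine mul_le_mul ?_ (ih fun ν hν => h ν (Multiset.mem_cons_of_mem hν)) (by positivity)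
        (norm_nonneg _)
      rw [norm_sub_rev]
      exact h a (Multiset.mem_cons_self _ _)
  have := key (A t).charpoly.roots (fun ν hν => hcon ν
    (Matrix.mem_spectrum_iff_isRoot_charpoly.2 (Polynomial.isRoot_of_mem_roots hν)))
  rw [hcard] at this
  linarith

theorem aux_sep (S : Set ℂ) (hS : S.Finite) :
    ∃ r > 0, ∀ x ∈ S, ∀ y ∈ S, x ≠ y → 2 * r ≤ ‖x - y‖ := by
  by_cases h : S.Nontrivial
  · have := hS.infsep_pos_iff_nontrivial.2 h
    refine ⟨S.infsep / 2, by positivity, fun x hx y hy hxy => ?_⟩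
    have h1 : S.infsep ≤ dist x y := by
      have : Fintype S := hS.fintype
      exact Set.infsep_le_dist_of_mem hx hy hxy
    rw [dist_eq_norm] at h1
    linarith
  · rw [Set.not_nontrivial_iff] at h
    exact ⟨1, one_pos, fun x hx y hy hxy => absurd (h hx hy) hxy⟩

theorem aux_root_unique {n : ℕ} (A : unitInterval → Matrix (Fin n) (Fin n) ℂ) (hA : Continuous A)
    (hsimple : ∀ t, (spectrum ℂ (A t)).ncard = n) (t₀ : unitInterval) :
    ∃ r > 0, ∀ᶠ t in nhds t₀, ∀ μ ∈ spectrum ℂ (A t₀), ∀ x ∈ spectrum ℂ (A t),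
      ∀ y ∈ spectrum ℂ (A t), ‖x - μ‖ < r → ‖y - μ‖ < r → x = y := by
  obtain ⟨r, hr, hsep⟩ := aux_sep _ (Matrix.finite_spectrum (A t₀))
  refine ⟨r, hr, ?_⟩
  have h1 : ∀ᶠ t in nhds t₀, ∀ μ ∈ spectrum ℂ (A t₀), ∃ ν ∈ spectrum ℂ (A t), ‖ν - μ‖ < r :=
    (Filter.eventually_all_finite (Matrix.finite_spectrum (A t₀))).2
      fun μ hμ => aux_root_near A hA t₀ μ hμ r hr
  filter_upwards [h1] with t ht
  choose! φ hφ hφr using ht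
  have hclose : ∀ μ ∈ spectrum ℂ (A t₀), ∀ μ' ∈ spectrum ℂ (A t₀), ‖φ μ - μ'‖ < r → μ = μ' := by
    intro μ hμ μ' hμ' h
    by_contra hne
    have h2 := hsep μ hμ μ' hμ' hne
    have h3 : ‖μ - μ'‖ ≤ ‖φ μ - μ'‖ + ‖φ μ - μ‖ := by
      rw [show μ - μ' = (φ μ - μ') - (φ μ - μ) by ring]; exact norm_sub_le _ _
    linarith [hφr μ hμ]
  have hinj : Set.InjOn φ (spectrum ℂ (A t₀)) := by
    intro μ hμ μ' hμ' h
    exact hclose μ hμ μ' hμ' (by rw [h]; exact hφr μ' hμ')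
  have himg : φ '' spectrum ℂ (A t₀) = spectrum ℂ (A t) := by
    apply Set.eq_of_subset_of_ncard_le (by rintro _ ⟨μ, hμ, rfl⟩; exact hφ μ hμ) _
      (Matrix.finite_spectrum (A t))
    rw [hinj.ncard_image, hsimple, hsimple]
  intro μ hμ x hx y hy hxr hyr
  rw [← himg] at hx hy
  obtain ⟨a, ha, rfl⟩ := hx
  obtain ⟨b, hb, rfl⟩ := hy
  rw [hclose a ha μ hμ hxr, hclose b hb μ hμ hyr]

section
attribute [local instance] Matrix.linftyOpNormedRing Matrix.linftyOpNormedAlgebra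

theorem aux_spec_bound {n : ℕ} (A : unitInterval → Matrix (Fin n) (Fin n) ℂ) (hA : Continuous A) :
    ∃ M : ℝ, ∀ t, ∀ μ ∈ spectrum ℂ (A t), ‖μ‖ ≤ M := by
  have hc : Continuous fun t => ‖A t‖ * ‖(1 : Matrix (Fin n) (Fin n) ℂ)‖ :=
    hA.norm.mul continuous_const
  obtain ⟨M, hM⟩ := (isCompact_range hc).bddAbove
  refine ⟨M, fun t μ hμ => ?_⟩
  have : CompleteSpace (Matrix (Fin n) (Fin n) ℂ) := FiniteDimensional.complete ℂ _
  exact (spectrum.norm_le_norm_mul_of_mem hμ).trans (hM ⟨t, rfl⟩)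

end

theorem aux_selection {n : ℕ} (A : unitInterval → Matrix (Fin n) (Fin n) ℂ) (hA : Continuous A)
    (hsimple : ∀ t, (spectrum ℂ (A t)).ncard = n) :
    ∃ l : Fin n → unitInterval → ℂ, (∀ i, Continuous (l i)) ∧
      (∀ t, Function.Injective fun i => l i t) ∧ ∀ i t, l i t ∈ spectrum ℂ (A t) := by
  let E : Set (unitInterval × ℂ) := {p | p.2 ∈ spectrum ℂ (A p.1)}
  have hE : ∀ p : unitInterval × ℂ, p ∈ E ↔ (A p.1).charpoly.eval p.2 = 0 := fun p =>
    Matrix.mem_spectrum_iff_isRoot_charpoly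
  have hEc : IsClosed E := by
    have : E = (fun p : unitInterval × ℂ => (Matrix.scalar (Fin n) p.2 - A p.1).det) ⁻¹' {0} := by
      ext p; rw [hE, Matrix.eval_charpoly]; rfl
    rw [this]
    refine IsClosed.preimage ?_ isClosed_singleton
    refine Continuous.matrix_det (Continuous.sub ?_ (hA.comp continuous_fst))
    simp only [Matrix.scalar_apply]
    exact Continuous.matrix_diagonal (by fun_prop)
  obtain ⟨M, hM⟩ := aux_spec_bound A hA
  have hEcomp : IsCompact E := by
    refine (isCompact_univ.prod (isCompact_closedBall (0:ℂ) M)).of_isClosed_subset hEc ?_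
    rintro ⟨t, μ⟩ h
    exact ⟨trivial, by simpa using hM t μ h⟩
  have : CompactSpace E := isCompact_iff_compactSpace.1 hEcomp
  let π : E → unitInterval := fun p => p.1.1
  have hπ : Continuous π := by fun_prop
  have hopen : IsOpenMap π := by
    rw [isOpenMap_iff_nhds_le]
    rintro ⟨⟨t₀, μ⟩, hp⟩ U hU
    rw [Filter.mem_map, nhds_subtype_eq_comap, Filter.mem_comap] at hU
    obtain ⟨W, hW, hWU⟩ := hU
    rw [nhds_prod_eq, Filter.mem_prod_iff] at hW
    obtain ⟨W1, hW1, W2, hW2, hW12⟩ := hW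
    obtain ⟨r, hr, hrW⟩ := Metric.mem_nhds_iff.1 hW2
    change U ∈ nhds t₀
    filter_upwards [hW1, aux_root_near A hA t₀ μ hp r hr] with t ht ⟨ν, hν, hνr⟩
    exact hWU (show (⟨(t, ν), hν⟩ : E) ∈ _ from
      hW12 ⟨ht, hrW (by rwa [Metric.mem_ball, dist_eq_norm])⟩)
  have hloc : IsLocalHomeomorph π := by
    rw [isLocalHomeomorph_iff_isOpenEmbedding_restrict]
    rintro ⟨⟨t₀, μ⟩, hp⟩
    obtain ⟨r, hr, hu⟩ := aux_root_unique A hA hsimple t₀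
    obtain ⟨W, hWsub, hWo, hWt⟩ := eventually_nhds_iff.1 hu
    let U : Set E := {p | p.1.1 ∈ W ∧ ‖p.1.2 - μ‖ < r}
    have hUo : IsOpen U := by
      have h2 : IsOpen {p : E | ‖p.1.2 - μ‖ < r} := isOpen_lt (by fun_prop) continuous_const
      exact (hWo.preimage hπ).inter h2
    refine ⟨U, hUo.mem_nhds ⟨hWt, by simpa using hr⟩, ?_⟩
    refine .of_continuous_injective_isOpenMap (hπ.comp continuous_subtype_val) ?_
      (hopen.domRestrict hUo)
    rintro ⟨⟨⟨t, x⟩, hx⟩, hxW, hxr⟩ ⟨⟨⟨t', y⟩, hy⟩, hyW, hyr⟩ h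
    have htt : t = t' := h
    subst htt
    have : x = y := hWsub t hxW μ hp x hx y hy hxr hyr
    subst this
    rfl
  have hcov : IsCoveringMap π := by
    rw [isCoveringMap_iff_isCoveringMapOn_univ]
    refine hπ.isClosedMap.isCoveringMapOn_of_isLocalHomeomorphOn (fun t _ => ?_)
      (hloc.isLocalHomeomorphOn)
    refine Set.Finite.of_finite_image (f := fun p : E => p.1.2)
      ((Matrix.finite_spectrum (A t)).subset ?_) ?_
    · rintro _ ⟨⟨⟨t', x⟩, hx⟩, h, rfl⟩
      have : t' = t := h
      subst this
      exact hx
    · rintro ⟨⟨t1, x⟩, hx⟩ h1 ⟨⟨t2, y⟩, hy⟩ h2 h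
      have e1 : t1 = t := h1
      have e2 : t2 = t := h2
      have e3 : x = y := h
      subst e1 e2 e3
      rfl
  -- index the fibre over `0`
  have hfin := Matrix.finite_spectrum (A 0)
  have : Finite (spectrum ℂ (A 0)) := hfin
  have hcard : Nat.card (spectrum ℂ (A 0)) = n := hsimple 0
  let ι : Fin n ≃ spectrum ℂ (A 0) := (Finite.equivFinOfCardEq hcard).symm
  have hlift : ∀ i : Fin n, ∃ Γ : C(unitInterval, E), π ∘ Γ = id ∧ Γ 0 = ⟨(0, (ι i).1), (ι i).2⟩ :=
    fun i => hcov.exists_path_lifts (ContinuousMap.id _) ⟨(0, (ι i).1), (ι i).2⟩ rfl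
  choose Γ hΓ hΓ0 using hlift
  have hΓt : ∀ i t, (Γ i t).1.1 = t := fun i t => congrFun (hΓ i) t
  refine ⟨fun i t => (Γ i t).1.2, fun i => by fun_prop, fun t i j hij => ?_, fun i t => ?_⟩
  · have h1 : Γ i t = Γ j t := by
      apply Subtype.ext
      exact Prod.ext ((hΓt i t).trans (hΓt j t).symm) hij
    have h2 := hcov.eq_of_comp_eq (Γ i).continuous (Γ j).continuous ((hΓ i).trans (hΓ j).symm) t h1
    have h3 := congrFun h2 0
    rw [hΓ0, hΓ0] at h3
    have h4 : (ι i).1 = (ι j).1 := congrArg (fun p : E => p.1.2) h3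
    exact ι.injective (Subtype.ext h4)
  · have := (Γ i t).2
    change (Γ i t).1.2 ∈ spectrum ℂ (A (Γ i t).1.1) at this
    rwa [hΓt] at this

theorem aux_lagrange {n : ℕ} (M : Matrix (Fin n) (Fin n) ℂ) (v : Fin n → ℂ)
    (hv : Function.Injective v) (hs : ∀ i, v i ∈ spectrum ℂ M) (q : ℂ[X]) :
    aeval M q = ∑ i, q.eval (v i) • aeval M (Lagrange.basis Finset.univ v i) := by
  have hdvd : ∀ u : ℂ[X], (∀ i, u.eval (v i) = 0) → (∏ i, (X - C (v i))) ∣ u := fun u hu =>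
    Finset.prod_dvd_of_coprime (fun i _ j _ hij => Polynomial.pairwise_coprime_X_sub_C hv hij)
      fun i _ => Polynomial.dvd_iff_isRoot.2 (hu i)
  have hchar : M.charpoly = ∏ i, (X - C (v i)) := by
    refine Polynomial.eq_of_monic_of_dvd_of_natDegree_le
      (Polynomial.monic_prod_of_monic _ _ fun i _ => Polynomial.monic_X_sub_C _)
      (Matrix.charpoly_monic M)
      (hdvd _ fun i => Matrix.mem_spectrum_iff_isRoot_charpoly.1 (hs i)) ?_
    rw [Matrix.charpoly_natDegree_eq_dim, Polynomial.natDegree_prod_of_monic _ _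
      fun i _ => Polynomial.monic_X_sub_C _]
    simp
  obtain ⟨w, hw⟩ := hdvd (q - Lagrange.interpolate Finset.univ v fun i => q.eval (v i)) (by
    intro i
    rw [eval_sub, Lagrange.eval_interpolate_at_node _ hv.injOn (Finset.mem_univ i), sub_self])
  rw [← hchar] at hw
  have h := congrArg (aeval M) hw
  rw [map_mul, Matrix.aeval_self_charpoly, zero_mul, map_sub, sub_eq_zero] at h
  rw [h, Lagrange.interpolate_apply, map_sum]
  refine Finset.sum_congr rfl fun i _ => ?_
  rw [map_mul, aeval_C, Algebra.smul_def]

theorem aux_basis_cont {n : ℕ} (A : unitInterval → Matrix (Fin n) (Fin n) ℂ) (hA : Continuous A)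
    (l : Fin n → unitInterval → ℂ) (hl : ∀ i, Continuous (l i))
    (hinj : ∀ t, Function.Injective fun i => l i t) (i : Fin n) :
    Continuous fun t => aeval (A t) (Lagrange.basis Finset.univ (fun i => l i t) i) := by
  have key : ∀ s : Finset (Fin n), i ∉ s → Continuous fun t => aeval (A t)
      (∏ j ∈ s, Lagrange.basisDivisor (l i t) (l j t)) := by
    intro s
    induction s using Finset.induction_on with
    | empty => intro _; simpa using continuous_const
    | insert j s hj ih =>
      intro hi
      rw [Finset.mem_insert, not_or] at hi
      simp_rw [Finset.prod_insert hj, map_mul]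
      refine Continuous.mul ?_ (ih hi.2)
      simp only [Lagrange.basisDivisor, map_mul, map_sub, aeval_C, aeval_X, Algebra.algebraMap_eq_smul_one]
      have h1 : Continuous fun t => (l i t - l j t)⁻¹ :=
        ((hl i).sub (hl j)).inv₀ fun t h => hi.1 (hinj t (sub_eq_zero.1 h))
      have h2 := hl j
      fun_prop
  exact key _ (Finset.notMem_erase _ _)

theorem aux_main {n : ℕ} (A : unitInterval → Matrix (Fin n) (Fin n) ℂ) (b : unitInterval → Fin n → ℂ)
    (hA : Continuous A) (hb : Continuous b)
    (hrank : ∀ t, (Matrix.of fun i k : Fin n => ((A t ^ (k : ℕ)).mulVec (b t)) i).rank = n)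
    (hspec : ∀ s t, s ≠ t → Disjoint (spectrum ℂ (A s)) (spectrum ℂ (A t)))
    (hsimple : ∀ t, (spectrum ℂ (A t)).ncard = n)
    (f : unitInterval → Fin n → ℂ) (hf : Continuous f) (ε : ℝ) (hε : 0 < ε) :
    ∃ p : ℂ[X], ∀ t, ‖(aeval (A t) p).mulVec (b t) - f t‖ < ε := by
  obtain ⟨l, hl, hinj, hls⟩ := aux_selection A hA hsimple
  let K : unitInterval → Matrix (Fin n) (Fin n) ℂ := fun t =>
    Matrix.of fun i k : Fin n => ((A t ^ (k : ℕ)).mulVec (b t)) i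
  have hK : Continuous K := by
    refine continuous_matrix fun i k => ?_
    exact (continuous_apply i).comp ((hA.pow _).matrix_mulVec hb)
  have hunit : ∀ t, IsUnit (K t).det := by
    intro t
    rw [← Matrix.isUnit_iff_isUnit_det]
    rw [← Matrix.mulVec_surjective_iff_isUnit]
    have h1 : Module.finrank ℂ (LinearMap.range (K t).mulVecLin) = n := hrank t
    have h2 : LinearMap.range (K t).mulVecLin = ⊤ :=
      Submodule.eq_top_of_finrank_eq (by rw [h1]; simp)
    exact LinearMap.range_eq_top.1 h2
  let c : unitInterval → Fin n → ℂ := fun t => ((K t)⁻¹).mulVec (f t)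
  have hc : Continuous c := by
    refine Continuous.matrix_mulVec ?_ hf
    simp_rw [Matrix.inv_def, Ring.inverse_eq_inv']
    exact (hK.matrix_det.inv₀ fun t => (hunit t).ne_zero).smul hK.matrix_adjugate
  let q : unitInterval → ℂ[X] := fun t => ∑ k : Fin n, C (c t k) * X ^ (k : ℕ)
  have hq : ∀ t, (aeval (A t) (q t)).mulVec (b t) = f t := by
    intro t
    have h1 : (K t).mulVec (c t) = f t := by
      simp only [c]
      rw [Matrix.mulVec_mulVec, Matrix.mul_nonsing_inv _ (hunit t), Matrix.one_mulVec]
    rw [← h1]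
    simp only [q, map_sum, map_mul, aeval_C, map_pow, aeval_X, Matrix.sum_mulVec]
    ext i
    have h2 : ((K t).mulVec (c t)) i =
        ∑ k : Fin n, ((A t ^ (k : ℕ)).mulVec (b t)) i * c t k := rfl
    rw [h2, Finset.sum_apply]
    refine Finset.sum_congr rfl fun k _ => ?_
    rw [← Algebra.smul_def, Matrix.smul_mulVec, Pi.smul_apply, smul_eq_mul, mul_comm]
  have hqe : ∀ t z, (q t).eval z = ∑ k : Fin n, c t k * z ^ (k : ℕ) := by
    intro t z; simp [q, eval_finsetSum]
  let w : Fin n → unitInterval → Fin n → ℂ := fun i t =>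
    (aeval (A t) (Lagrange.basis Finset.univ (fun i => l i t) i)).mulVec (b t)
  have hw : ∀ i, Continuous (w i) := fun i => (aux_basis_cont A hA l hl hinj i).matrix_mulVec hb
  have hsum : Continuous fun t => ∑ i, ‖w i t‖ := by fun_prop
  obtain ⟨M, hM⟩ := (isCompact_range hsum).bddAbove
  have hM0 : ∀ t, ∑ i, ‖w i t‖ ≤ M := fun t => hM ⟨t, rfl⟩
  have hMpos : 0 ≤ M := (Finset.sum_nonneg fun i _ => norm_nonneg (w i 0)).trans (hM0 0)
  obtain ⟨p, hp⟩ := aux_poly_approx (fun x => l x.1 x.2) (continuous_prod_of_discrete_left.2 hl)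
    (by
      rintro ⟨i, s⟩ ⟨j, t⟩ h
      have hst : s = t := by
        by_contra hne
        exact Set.disjoint_left.1 (hspec s t hne) (hls i s) (by
          have h' : l i s = l j t := h
          rw [h']; exact hls j t)
      subst hst
      have hij : i = j := hinj s h
      rw [hij])
    (fun x => (q x.2).eval (l x.1 x.2)) (by
      simp_rw [hqe]
      refine continuous_prod_of_discrete_left.2 fun i => ?_
      exact continuous_finsetSum _ fun k _ =>
        ((continuous_apply k).comp hc).mul ((hl i).pow _)) (ε / (M + 1)) (by positivity)
  refine ⟨p, fun t => ?_⟩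
  rw [← hq t, ← Matrix.sub_mulVec, ← map_sub, aux_lagrange (A t) (fun i => l i t) (hinj t)
    (fun i => hls i t), Matrix.sum_mulVec]
  calc _ ≤ ∑ i, ‖w i t‖ * (ε / (M + 1)) := by
        refine (norm_sum_le _ _).trans (Finset.sum_le_sum fun i _ => ?_)
        rw [Matrix.smul_mulVec, norm_smul, mul_comm, eval_sub]
        exact mul_le_mul_of_nonneg_left (hp (i, t)).le (norm_nonneg _)
    _ = (∑ i, ‖w i t‖) * (ε / (M + 1)) := by rw [Finset.sum_mul]
    _ ≤ M * (ε / (M + 1)) := by gcongr; exact hM0 t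
    _ < ε := by
        rw [mul_div_assoc', div_lt_iff₀ (by positivity)]
        nlinarith

/-- if `P ⊆ ℂ` is compact and homeomorphic to `[0,1]`, the pairs
`(A(θ), b(θ))` are pointwise reachable, the spectra are pairwise disjoint, and every
`A(θ)` has `n` distinct (i.e. simple) eigenvalues, then `(A, b)` is uniformly ensemble
reachable. -/
theorem stmt_11 {n : ℕ} (P : Set ℂ) (hP : IsCompact P)
    (hhomeo : Nonempty (P ≃ₜ (Set.Icc (0 : ℝ) 1)))
    (A : P → Matrix (Fin n) (Fin n) ℂ) (b : P → Fin n → ℂ)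
    (hA : Continuous A) (hb : Continuous b)
    (hrank : ∀ θ : P, (Matrix.of fun i k : Fin n => ((A θ ^ (k : ℕ)).mulVec (b θ)) i).rank = n)
    (hspec : ∀ θ θ' : P, θ ≠ θ' → Disjoint (spectrum ℂ (A θ)) (spectrum ℂ (A θ')))
    (hsimple : ∀ θ : P, (spectrum ℂ (A θ)).ncard = n) :
    UniformEnsembleReachable1 P A b := by
  obtain ⟨φ⟩ := hhomeo
  intro f hf ε hε
  obtain ⟨p, hp⟩ := aux_main (fun t => A (φ.symm t)) (fun t => b (φ.symm t))
    (hA.comp φ.symm.continuous) (hb.comp φ.symm.continuous) (fun t => hrank _)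
    (fun s t hst => hspec _ _ fun h => hst (φ.symm.injective h)) (fun t => hsimple _)
    (fun t => f (φ.symm t)) (hf.comp φ.symm.continuous) ε hε
  refine ⟨p, fun θ => ?_⟩
  simpa using hp (φ θ)
end
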